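/- Let f₁(x) = x¹² + 24x¹¹ + 204x¹⁰ + 912x⁹ + 2676x⁸ + 4032x⁷ + 9056x⁶ − 1920x⁵ + 7728x⁴ − 16512x³ − 20544x² − 6912x − 1088 ∈ ℚ[x] (the specialization t ↦ 0 of the family in Theorem 'm11_5er'). Then f₁ is irreducible over ℚ, the Galois group of its splitting field over ℚ has cardinality 720 (it is the Mathieu group M₁₀ acting transitively on the 12 roots), and the root field K = ℚ[x]/(f₁) is a degree-12 number field with discriminant 2³⁸·3¹². -/

import Mathlib

open Polynomial

/-- `f₁(x) = x¹² + 24x¹¹ + 204x¹⁰ + 912x⁹ + 2676x⁸ + 4032x⁷ + 9056x⁶ − 1920x⁵ + 7728x⁴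
  − 16512x³ − 20544x² − 6912x − 1088` over `ℚ` (the specialization `t ↦ 0`). -/
noncomputable def f1 : Polynomial ℚ :=
  X ^ 12 + 24 * X ^ 11 + 204 * X ^ 10 + 912 * X ^ 9 + 2676 * X ^ 8 + 4032 * X ^ 7 +
    9056 * X ^ 6 - 1920 * X ^ 5 + 7728 * X ^ 4 - 16512 * X ^ 3 - 20544 * X ^ 2 -
    6912 * X - 1088

open Polynomial

namespace M10

/-- evaluation of an integer coefficient list -/
def ev {R : Type*} [CommRing R] : List ℤ → R → R
  | [], _ => 0
  | c :: l, x => (c : R) + x * ev l x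

def addl : List ℤ → List ℤ → List ℤ
  | [], b => b
  | a :: l, [] => a :: l
  | a :: l, b :: m => (a + b) :: addl l m

def smull (c : ℤ) (l : List ℤ) : List ℤ := l.map (fun a => c * a)

def redl (q : ℤ) (l : List ℤ) : List ℤ := l.map (fun a => a % q)

/-- lower part of the small polynomial -/
def rl : List ℤ := [-4, 0, -12, -32, 9, 0, -28, 0, -6, 0, 0, 0]

def xm (l : List ℤ) : List ℤ :=
  if l.length = 12 then addl (0 :: l.dropLast) (smull (-(l.getLastD 0)) rl) else 0 :: l

def mm (q : ℤ) : List ℤ → List ℤ → List ℤ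
  | [], _ => []
  | c :: l, b => redl q (addl (smull c b) (xm (mm q l b)))

def pown (q : ℤ) (l : List ℤ) : ℕ → List ℤ
  | 0 => [1]
  | n + 1 => mm q (pown q l n) l

def frob (p : ℕ) : ℕ → List ℤ
  | 0 => [0, 1]
  | n + 1 => pown p (frob p n) p

/-- scaled composition -/
def comp (D : ℤ) (a : List ℤ) : List ℤ → List ℤ × ℤ
  | [] => ([], 1)
  | c :: l => (addl [c * (D * (comp D a l).2)] (mm 0 a (comp D a l).1), D * (comp D a l).2)

section
variable {R : Type*} [CommRing R]

lemma ev_addl (a b : List ℤ) (x : R) : ev (addl a b) x = ev a x + ev b x := by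
  induction a generalizing b with
  | nil => simp [addl, ev]
  | cons c l ih =>
    cases b with
    | nil => simp [addl, ev]
    | cons d m => simp only [addl, ev, ih]; push_cast; ring

lemma ev_smull (c : ℤ) (l : List ℤ) (x : R) : ev (smull c l) x = c * ev l x := by
  induction l with
  | nil => simp [smull, ev]
  | cons d m ih =>
    simp only [smull, List.map_cons, ev] at *
    rw [ih]; push_cast; ring

lemma ev_redl (q : ℤ) (hq : (q : R) = 0) (l : List ℤ) (x : R) : ev (redl q l) x = ev l x := by
  induction l with
  | nil => simp [redl, ev]
  | cons d m ih =>
    simp only [redl, List.map_cons, ev] at *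
    rw [ih]
    have : (d : R) = ((d % q + q * (d / q) : ℤ) : R) := by rw [Int.emod_add_mul_ediv]
    rw [this]; push_cast; rw [hq]; ring

lemma ev_append (a b : List ℤ) (x : R) : ev (a ++ b) x = ev a x + x ^ a.length * ev b x := by
  induction a with
  | nil => simp [ev]
  | cons c l ih => simp only [List.cons_append, ev, ih, List.length_cons]; ring

lemma ev_xm (x : R) (hx : x ^ 12 + ev rl x = 0) (l : List ℤ) : ev (xm l) x = x * ev l x := by
  unfold xm
  split_ifs with h
  · have hne : l ≠ [] := by rintro rfl; simp at h
    have h1 : l = l.dropLast ++ [l.getLastD 0] := by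
      rw [List.getLastD_eq_getLast?, List.getLast?_eq_some_getLast hne]
      simp [List.dropLast_append_getLast hne]
    have h2 : l.dropLast.length = 11 := by simp [h]
    have h3 := ev_append l.dropLast [l.getLastD 0] x
    rw [← h1, h2] at h3
    rw [ev_addl, ev_smull, h3]
    have : ev rl x = - x ^ 12 := by linear_combination hx
    rw [this]
    simp only [ev]; push_cast; ring
  · simp [ev]

lemma ev_mm (q : ℤ) (hq : (q : R) = 0) (x : R) (hx : x ^ 12 + ev rl x = 0) (a b : List ℤ) :
    ev (mm q a b) x = ev a x * ev b x := by
  induction a with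
  | nil => simp [mm, ev]
  | cons c l ih =>
    rw [mm, ev_redl q hq, ev_addl, ev_smull, ev_xm x hx, ih, ev]; ring

lemma ev_pown (q : ℤ) (hq : (q : R) = 0) (x : R) (hx : x ^ 12 + ev rl x = 0) (a : List ℤ) (n : ℕ) :
    ev (pown q a n) x = ev a x ^ n := by
  induction n with
  | zero => simp [pown, ev]
  | succ n ih => rw [pown, ev_mm q hq x hx, ih, pow_succ]

lemma ev_frob (p : ℕ) (hq : (p : R) = 0) (x : R) (hx : x ^ 12 + ev rl x = 0) (n : ℕ) :
    ev (frob p n) x = x ^ p ^ n := by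
  induction n with
  | zero => simp [frob, ev]
  | succ n ih => rw [frob, ev_pown p (by simpa using hq) x hx, ih, ← pow_mul, pow_succ]

lemma ev_comp (x y : R) (hx : x ^ 12 + ev rl x = 0) (D : ℤ) (a : List ℤ)
    (hy : (D : R) * y = ev a x) (l : List ℤ) :
    ev (comp D a l).1 x = (comp D a l).2 * ev l y := by
  induction l with
  | nil => simp [comp, ev]
  | cons c l ih =>
    simp only [comp, ev_addl, ev_mm 0 (by simp) x hx, ih, ev, ← hy]
    push_cast; ring

lemma ev_map {S : Type*} [CommRing S] (φ : R →+* S) (l : List ℤ) (x : R) :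
    φ (ev l x) = ev l (φ x) := by
  induction l with
  | nil => simp [ev]
  | cons c l ih => simp [ev, ih]

lemma ev_zero_of (l : List ℤ) (h : l.all (fun a => a == 0) = true) (x : R) : ev l x = 0 := by
  induction l with
  | nil => simp [ev]
  | cons c l ih =>
    simp only [List.all_cons, Bool.and_eq_true, beq_iff_eq] at h
    simp [ev, ih h.2, h.1]
end

def f1l : List ℤ := [-1088, -6912, -20544, -16512, 7728, -1920, 9056, 4032, 2676, 912, 204, 24, 1]
def Al : List ℤ := [-2636, 3800, -12530, -2139, 9255, -11919, 1852, -2239, -95, 181, -310, 388]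
def Pl : List ℤ := [1833632, 7751328, 12561904, -6031248, 2755904, -5212704, -2130640, -1549728,
  -544970, -125730, -15139, -639]
def sl : List ℤ := [-210, 128, -525, -348, 516, -774, 87, -136, -12, 18, -16, 24]
def h2l : List ℤ := [162, 0, -324, 0, -54, -216, 36, -72, -45, 48, -18, 0, 1]
def h3l : List ℤ := [-368, -288, 888, 888, -495, -696, 36, 216, 42, -24, -12, 0, 1]
def t2l : List ℤ := [1300, -3182, 11368, 1587, -9579, 12867, -1769, 2461, 145, -179, 307, -422]
def t3l : List ℤ := [1248, -3412, 11480, 3852, -10434, 13803, -1920, 2495, 170, -255, 344, -439]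
def V2l : List ℤ := [125269011, -153963180, -103546782, 102737133, -175808448, 18658521, 11002851,
  -73946151, 46375533, -12624090, -641259, 734041]
def V3l : List ℤ := [-27944, -164, 67130, 14913, -48704, -14580, 13932, 5418, -1032, -1000, -126, 97]

lemma cert_f1 : (comp 462 Al f1l).1.all (fun a => a == 0) = true ∧ (comp 462 Al f1l).2 ≠ 0 := by
  decide +kernel
lemma cert_P : (addl (comp 462 Al Pl).1 [0, -1170432 * (comp 462 Al Pl).2]).all (fun a => a == 0) = true
    ∧ (comp 462 Al Pl).2 ≠ 0 := by
  decide +kernel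
lemma cert_h2 : (comp 924 t2l h2l).1.all (fun a => a == 0) = true ∧ (comp 924 t2l h2l).2 ≠ 0 := by
  decide +kernel
lemma cert_h3 : (comp 924 t3l h3l).1.all (fun a => a == 0) = true ∧ (comp 924 t3l h3l).2 ≠ 0 := by
  decide +kernel
lemma cert_V2 : (addl (comp 924 t2l V2l).1 [0, -18865629 * (comp 924 t2l V2l).2]).all (fun a => a == 0) = true
    ∧ (comp 924 t2l V2l).2 ≠ 0 := by
  decide +kernel
lemma cert_V3 : (addl (comp 924 t3l V3l).1 [0, -64 * (comp 924 t3l V3l).2]).all (fun a => a == 0) = true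
    ∧ (comp 924 t3l V3l).2 ≠ 0 := by
  decide +kernel
lemma cert_s : (addl (mm 0 sl sl) [-2 * 66 ^ 2]).all (fun a => a == 0) = true := by
  decide +kernel

lemma frob5_8 : (addl (frob 5 8) [0, -1]).all (fun a => a % 5 == 0) = true := by decide +kernel
lemma frob17_3 : (addl (frob 17 3) [0, -1]).all (fun a => a % 17 == 0) = true := by decide +kernel
lemma frob23_5 : (addl (frob 23 5) [0, -1]).all (fun a => a % 23 == 0) = true := by decide +kernel

end M10

open Polynomial
set_option linter.all false
set_option linter.deprecated false

namespace M10

lemma ev_zero_mod {R : Type*} [CommRing R] (p : ℕ) (hp : (p : R) = 0) (l : List ℤ)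
    (h : l.all (fun a => a % p == 0) = true) (x : R) : ev l x = 0 := by
  rw [← ev_redl (p : ℤ) (by simpa using hp)]
  apply ev_zero_of
  simpa [redl] using h

/-- the small polynomial over a ring -/
noncomputable def rho (R : Type*) [CommRing R] : R[X] :=
  X ^ 12 - 6 * X ^ 8 - 28 * X ^ 6 + 9 * X ^ 4 - 32 * X ^ 3 - 12 * X ^ 2 - 4

section
variable {R : Type*} [CommRing R]

lemma rho_map {S : Type*} [CommRing S] (φ : R →+* S) : (rho R).map φ = rho S := by
  simp [rho, Polynomial.map_sub, Polynomial.map_add, Polynomial.map_mul, Polynomial.map_pow]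

lemma rho_eval (x : R) : (rho R).eval x = x ^ 12 + ev rl x := by
  simp [rho, ev, rl]; ring

lemma rho_natDegree [Nontrivial R] : (rho R).natDegree = 12 := by
  unfold rho; compute_degree!

lemma rho_monic : (rho R).Monic := by
  nontriviality R
  unfold rho; monicity!

lemma rho_deriv (x : R) : (rho R).derivative.eval x =
    ev [0, -24, -96, 36, 0, -168, 0, -48, 0, 0, 0, 12] x := by
  simp [rho, ev]; ring
end

def ud5 : List ℤ := [2, 2, 1, 1, 0, 2, 0, 2, 3, 0, 2, 4]
def ud17 : List ℤ := [11, 5, 2, 14, 5, 12, 5, 6, 7, 11, 2, 4]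
def ud23 : List ℤ := [0, 5, 7, 4, 8, 10, 12, 13, 6, 19, 5, 16]
def u25 : List ℤ := [4, 1, 0, 3, 4, 0, 4, 3, 2, 0, 3, 4]
def dl : List ℤ := [0, -24, -96, 36, 0, -168, 0, -48, 0, 0, 0, 12]

lemma cert_d5 : (addl (mm 5 ud5 dl) [-1]).all (fun a => a % (5 : ℕ) == 0) = true := by decide +kernel
lemma cert_d17 : (addl (mm 17 ud17 dl) [-1]).all (fun a => a % (17 : ℕ) == 0) = true := by decide +kernel
lemma cert_d23 : (addl (mm 23 ud23 dl) [-1]).all (fun a => a % (23 : ℕ) == 0) = true := by decide +kernel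
lemma cert_u25 : (addl (mm 5 u25 (addl (frob 5 2) [0, -1])) [-1]).all (fun a => a % (5 : ℕ) == 0) = true := by
  decide +kernel

/-- separability from a certificate -/
lemma rho_sep (p : ℕ) (u : List ℤ)
    (h : (addl (mm p u dl) [-1]).all (fun a => a % p == 0) = true)
    (F : Type*) [Field F] (hp : (p : F) = 0) : (rho F).Separable := by
  rw [separable_def]
  apply isCoprime_of_irreducible_dvd
  · rintro ⟨h1, -⟩
    exact rho_monic.ne_zero h1
  · intro q hq h1 h2
    have : Fact (Irreducible q) := ⟨hq⟩
    have hp' : (p : AdjoinRoot q) = 0 := by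
      rw [← map_natCast (AdjoinRoot.of q), hp, map_zero]
    have e1 : (rho (AdjoinRoot q)).eval (AdjoinRoot.root q) = 0 := by
      rw [← rho_map (AdjoinRoot.of q), eval_map]
      obtain ⟨c, hc⟩ := h1
      rw [hc, eval₂_mul, AdjoinRoot.eval₂_root, zero_mul]
    have e2 : (rho (AdjoinRoot q)).derivative.eval (AdjoinRoot.root q) = 0 := by
      rw [← rho_map (AdjoinRoot.of q), derivative_map, eval_map]
      obtain ⟨c, hc⟩ := h2
      rw [hc, eval₂_mul, AdjoinRoot.eval₂_root, zero_mul]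
    rw [rho_eval] at e1
    have := ev_zero_mod p hp' _ h (AdjoinRoot.root q)
    rw [ev_addl, ev_mm (p : ℤ) (by simpa using hp') _ e1] at this
    rw [rho_deriv] at e2
    change _ * ev [0, -24, -96, 36, 0, -168, 0, -48, 0, 0, 0, 12] _ + _ = (0 : AdjoinRoot q) at this
    rw [e2] at this
    simp [ev] at this

lemma factor_root {p : ℕ} [Fact p.Prime] (q : (ZMod p)[X]) (hd : q ∣ rho (ZMod p)) :
    AdjoinRoot.root q ^ 12 + ev rl (AdjoinRoot.root q) = 0 ∧ (p : AdjoinRoot q) = 0 := by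
  constructor
  · rw [← rho_eval, ← rho_map (AdjoinRoot.of q), eval_map]
    obtain ⟨c, hc⟩ := hd
    rw [hc, eval₂_mul, AdjoinRoot.eval₂_root, zero_mul]
  · rw [← map_natCast (AdjoinRoot.of q)]; simp

lemma factor_deg {p : ℕ} [Fact p.Prime] (n : ℕ)
    (h : (addl (frob p n) [0, -1]).all (fun a => a % p == 0) = true)
    (q : (ZMod p)[X]) (hq : Irreducible q) (hd : q ∣ rho (ZMod p)) : q.natDegree ∣ n := by
  rw [hq.natDegree_dvd_iff_dvd_X_pow_card_pow_sub_X, ← AdjoinRoot.mk_eq_zero]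
  obtain ⟨h1, h2⟩ := factor_root q hd
  have := ev_zero_mod p h2 _ h (AdjoinRoot.root q)
  rw [ev_addl, ev_frob p h2 _ h1] at this
  simp [ev] at this ⊢
  linear_combination this

lemma factor_deg5 (q : (ZMod 5)[X]) (hq : Irreducible q) (hd : q ∣ rho (ZMod 5)) : 4 ∣ q.natDegree := by
  have : Fact (Nat.Prime 5) := ⟨by norm_num⟩
  have h8 := factor_deg 8 frob5_8 q hq hd
  have h2 : ¬ q.natDegree ∣ 2 := by
    rw [hq.natDegree_dvd_iff_dvd_X_pow_card_pow_sub_X, ← AdjoinRoot.mk_eq_zero]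
    have : Fact (Irreducible q) := ⟨hq⟩
    obtain ⟨h1, h2⟩ := factor_root q hd
    intro h3
    have := ev_zero_mod 5 h2 _ cert_u25 (AdjoinRoot.root q)
    rw [ev_addl, ev_mm 5 (by simpa using h2) _ h1, ev_addl, ev_frob 5 h2 _ h1] at this
    simp [ev] at this h3
    have h4 : AdjoinRoot.root q ^ 25 + -AdjoinRoot.root q = 0 := by linear_combination h3
    rw [h4] at this
    simp at this
  have : q.natDegree ∈ Nat.divisors 8 := by simp [h8]
  rw [show Nat.divisors 8 = {1, 2, 4, 8} by decide] at this
  simp only [Finset.mem_insert, Finset.mem_singleton] at this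
  rcases this with h | h | h | h <;> rw [h] at h2 ⊢ <;> revert h2 <;> decide

lemma four_dvd (n : ℕ) (g : (ZMod 5)[X]) (hg : g.natDegree = n) (hd : g ∣ rho (ZMod 5)) : 4 ∣ n := by
  have : Fact (Nat.Prime 5) := ⟨by norm_num⟩
  induction n using Nat.strong_induction_on generalizing g with
  | _ n ih =>
    by_cases h0 : n = 0
    · simp [h0]
    have hg0 : g ≠ 0 := by rintro rfl; simp at hg; omega
    have hu : ¬ IsUnit g := by
      intro h; have := natDegree_eq_zero_of_isUnit h; omega
    obtain ⟨q, hq, k, rfl⟩ := WfDvdMonoid.exists_irreducible_factor hu hg0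
    have h1 := factor_deg5 q hq ((dvd_mul_right _ _).trans hd)
    have hk : k ≠ 0 := right_ne_zero_of_mul hg0
    rw [natDegree_mul hq.ne_zero hk] at hg
    have h2 := ih k.natDegree (by have := hq.natDegree_pos; omega) k rfl ((dvd_mul_left _ _).trans hd)
    rw [← hg]; exact dvd_add h1 h2

lemma roots23 : ∀ x : ZMod 23, x ^ 12 - 6 * x ^ 8 - 28 * x ^ 6 + 9 * x ^ 4 - 32 * x ^ 3 - 12 * x ^ 2 - 4 = 0 →
      x ∈ ({4, 9} : Finset (ZMod 23)) := by decide +kernel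

lemma no_deg4 (g : (ZMod 23)[X]) (hg : g.natDegree = 4) (hd : g ∣ rho (ZMod 23)) : False := by
  have : Fact (Nat.Prime 23) := ⟨by norm_num⟩
  have hg0 : g ≠ 0 := by rintro rfl; simp at hg
  have hs : g.Splits := by
    rw [splits_iff_splits]
    right
    intro q hq hqg
    have h5 := factor_deg 5 frob23_5 q hq (hqg.trans hd)
    have h4 := natDegree_le_of_dvd hqg hg0
    have h6 := (Nat.prime_five.eq_one_or_self_of_dvd _ h5)
    have : q.natDegree = 1 := by omega
    rw [degree_eq_natDegree hq.ne_zero, this]; rfl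
  have h1 := hs.natDegree_eq_card_roots
  have hsep : (rho (ZMod 23)).Separable := rho_sep 23 ud23 cert_d23 (ZMod 23) (ZMod.natCast_self 23)
  have h2 : g.roots ≤ (rho (ZMod 23)).roots := roots.le_of_dvd rho_monic.ne_zero hd
  have h3 := Multiset.card_le_card h2
  have h4 : (rho (ZMod 23)).roots.card = (rho (ZMod 23)).roots.toFinset.card :=
    (Multiset.toFinset_card_of_nodup (nodup_roots hsep)).symm
  have h5 : (rho (ZMod 23)).roots.toFinset ⊆ {4, 9} := by
    intro x hx
    rw [Multiset.mem_toFinset, mem_roots rho_monic.ne_zero, IsRoot.def] at hx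
    apply roots23
    simpa [rho] using hx
  have h6 := Finset.card_le_card h5
  have h7 : ({4, 9} : Finset (ZMod 23)).card ≤ 2 := Finset.card_le_two
  omega

theorem rhoZ_irred : Irreducible (rho ℤ) := by
  rw [rho_monic.irreducible_iff_lt_natDegree_lt]
  · intro q hq hdeg hd
    rw [rho_natDegree, Finset.mem_Ioc] at hdeg
    have h5 := map_dvd (mapRingHom (Int.castRingHom (ZMod 5))) hd
    have h23 := map_dvd (mapRingHom (Int.castRingHom (ZMod 23))) hd
    simp only [coe_mapRingHom, rho_map] at h5 h23
    have : Fact (Nat.Prime 5) := ⟨by norm_num⟩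
    have : Fact (Nat.Prime 23) := ⟨by norm_num⟩
    have h4 := four_dvd _ _ rfl h5
    rw [hq.natDegree_map] at h4
    refine no_deg4 _ ?_ h23
    rw [hq.natDegree_map]; omega
  · intro h
    have := rho_natDegree (R := ℤ)
    rw [h] at this; simp at this

theorem rho_irred : Irreducible (rho ℚ) := by
  have := (rho_monic (R := ℤ)).irreducible_iff_irreducible_map_fraction_map (K := ℚ)
  rw [← rho_map (algebraMap ℤ ℚ)]
  exact this.1 rhoZ_irred

end M10

open Polynomial
set_option linter.all false
set_option linter.deprecated false


namespace M10

lemma f1_natDegree : f1.natDegree = 12 := by unfold f1; compute_degree!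
lemma f1_monic : f1.Monic := by unfold f1; monicity!

lemma f1_aeval {F : Type*} [Field F] [Algebra ℚ F] (x : F) : aeval x f1 = ev f1l x := by
  simp only [f1, ev, f1l, map_add, map_sub, map_mul, map_pow, aeval_X, map_ofNat]; push_cast; ring

lemma rho_aeval {F : Type*} [Field F] [Algebra ℚ F] (x : F) : aeval x (rho ℚ) = x ^ 12 + ev rl x := by
  rw [← rho_eval, ← rho_map (algebraMap ℚ F), eval_map]; rfl

section
variable {F : Type*} [Field F] [CharZero F]

/-- the scaled evaluation gives a root -/
lemma comp_root (x : F) (hx : x ^ 12 + ev rl x = 0) (D : ℤ) (hD : D ≠ 0) (a l : List ℤ)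
    (h : (comp D a l).1.all (fun a => a == 0) = true ∧ (comp D a l).2 ≠ 0) :
    ev l (ev a x / D) = 0 := by
  have hD' : (D : F) ≠ 0 := by exact_mod_cast hD
  have h1 := ev_comp x (ev a x / D) hx D a (by field_simp) l
  rw [ev_zero_of _ h.1] at h1
  have : (((comp D a l).2 : ℤ) : F) ≠ 0 := by exact_mod_cast h.2
  rcases mul_eq_zero.1 h1.symm with h | h
  · exact absurd h this
  · exact h

lemma comp_inv (x : F) (hx : x ^ 12 + ev rl x = 0) (D : ℤ) (hD : D ≠ 0) (a l : List ℤ) (E : ℤ) (hE : E ≠ 0)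
    (h : (addl (comp D a l).1 [0, -E * (comp D a l).2]).all (fun a => a == 0) = true ∧ (comp D a l).2 ≠ 0) :
    x = ev l (ev a x / D) / E := by
  have hD' : (D : F) ≠ 0 := by exact_mod_cast hD
  have hE' : (E : F) ≠ 0 := by exact_mod_cast hE
  have h1 := ev_comp x (ev a x / D) hx D a (by field_simp) l
  have h2 := ev_zero_of _ h.1 x
  rw [ev_addl, h1] at h2
  have : (((comp D a l).2 : ℤ) : F) ≠ 0 := by exact_mod_cast h.2
  simp only [ev] at h2
  push_cast at h2
  rw [eq_div_iff hE']
  have : (((comp D a l).2 : ℤ) : F) * (x * E - ev l (ev a x / D)) = 0 := by linear_combination -h2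
  rcases mul_eq_zero.1 this with h | h
  · contradiction
  · exact sub_eq_zero.1 h

lemma f1_root (x : F) (hx : x ^ 12 + ev rl x = 0) : ev f1l (ev Al x / (462 : ℤ)) = 0 :=
  comp_root x hx 462 (by norm_num) Al f1l cert_f1

lemma f1_inv (x : F) (hx : x ^ 12 + ev rl x = 0) : x = ev Pl (ev Al x / (462 : ℤ)) / (1170432 : ℤ) :=
  comp_inv x hx 462 (by norm_num) Al Pl 1170432 (by norm_num) cert_P
end

lemma ev_mem {F : Type*} [Field F] [Algebra ℚ F] (A : Subalgebra ℚ F) (l : List ℤ) (x : F) (hx : x ∈ A) (E : ℤ) :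
    ev l x / E ∈ A := by
  have : ev l x ∈ A := by
    induction l with
    | nil => exact A.zero_mem
    | cons c l ih => exact A.add_mem (intCast_mem A c) (A.mul_mem hx ih)
  have h2 : ev l x / E = ((E : ℚ)⁻¹) • ev l x := by
    rw [Algebra.smul_def]; simp; ring
  rw [h2]; exact A.smul_mem this _

/-- a general minimal-polynomial transfer lemma -/
lemma minpoly_transfer {K : Type*} [Field K] [Algebra ℚ K] [CharZero K] (v : K) (hv : v ^ 12 + ev rl v = 0)
    (hfin : Module.finrank ℚ K = 12) (hgen : Algebra.adjoin ℚ {v} = ⊤)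
    (a l : List ℤ) (D E : ℤ)
    (hinv : v = ev l (ev a v / D) / E) (h : ℚ[X]) (hm : h.Monic) (hdeg : h.natDegree = 12)
    (h0 : aeval (ev a v / (D : K)) h = 0) :
    Algebra.adjoin ℚ {(ev a v / (D : K))} = ⊤ ∧ minpoly ℚ (ev a v / (D : K)) = h := by
  have : FiniteDimensional ℚ K := Module.finite_of_finrank_pos (by omega)
  have h1 : Algebra.adjoin ℚ {(ev a v / (D : K))} = ⊤ := by
    rw [eq_top_iff, ← hgen]
    apply Algebra.adjoin_le
    rintro x rfl
    have := ev_mem (Algebra.adjoin ℚ {(ev a x / (D : K))}) l _ (Algebra.subset_adjoin rfl) E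
    rw [← hinv] at this
    exact this
  refine ⟨h1, ?_⟩
  set y := ev a v / (D : K)
  have hi : IsIntegral ℚ y := .of_finite ℚ y
  have h2 : (minpoly ℚ y).natDegree = 12 := by
    rw [← IntermediateField.adjoin.finrank hi, ← hfin]
    have : IntermediateField.adjoin ℚ {y} = ⊤ := by
      rw [← IntermediateField.toSubalgebra_inj, IntermediateField.adjoin_simple_toSubalgebra_of_isAlgebraic hi.isAlgebraic, h1]
      rfl
    rw [this]
    exact IntermediateField.finrank_top'
  exact Eq.symm <| by
    have := minpoly.dvd ℚ y h0
    refine eq_of_monic_of_dvd_of_natDegree_le ?_ ?_ ?_ ?_ <;> first | assumption | exact minpoly.monic hi | omega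
  -- exact (eq_of_monic_of_dvd_of_natDegree_le (minpoly.monic hi) hm (minpoly.dvd _ _ h0) (by omega)).symm

lemma rho_adjoinRoot : (AdjoinRoot.root (rho ℚ)) ^ 12 + ev rl (AdjoinRoot.root (rho ℚ)) = 0 := by
  rw [← rho_eval, ← rho_map (AdjoinRoot.of (rho ℚ)), eval_map, AdjoinRoot.eval₂_root]

instance : Fact (Irreducible (rho ℚ)) := ⟨rho_irred⟩

lemma finrank_adjoinRoot : Module.finrank ℚ (AdjoinRoot (rho ℚ)) = 12 := by
  rw [(AdjoinRoot.powerBasis rho_monic.ne_zero).finrank, AdjoinRoot.powerBasis_dim, rho_natDegree]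

lemma f1_transfer : Algebra.adjoin ℚ {(ev Al (AdjoinRoot.root (rho ℚ)) / ((462 : ℤ) : AdjoinRoot (rho ℚ)))} = ⊤ ∧
    minpoly ℚ (ev Al (AdjoinRoot.root (rho ℚ)) / ((462 : ℤ) : AdjoinRoot (rho ℚ))) = f1 := by
  have : CharZero (AdjoinRoot (rho ℚ)) := algebraRat.charZero _
  refine minpoly_transfer _ rho_adjoinRoot finrank_adjoinRoot ?_ Al Pl 462 1170432 ?_ f1 f1_monic f1_natDegree ?_
  · exact AdjoinRoot.adjoinRoot_eq_top
  · exact f1_inv _ rho_adjoinRoot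
  · rw [f1_aeval]; exact f1_root _ rho_adjoinRoot

theorem f1_irred : Irreducible f1 := by
  have := f1_transfer.2
  rw [← this]
  have : FiniteDimensional ℚ (AdjoinRoot (rho ℚ)) := Module.finite_of_finrank_pos (by rw [finrank_adjoinRoot]; norm_num)
  exact minpoly.irreducible (.of_finite ℚ _)

/-- every field isomorphic to the root field contains a generating root of rho. -/
lemma exists_v (K : Type) [Field K] [Algebra ℚ K] (e : AdjoinRoot f1 ≃ₐ[ℚ] K) :
    Module.finrank ℚ K = 12 ∧ ∃ v : K, v ^ 12 + ev rl v = 0 ∧ Algebra.adjoin ℚ {v} = ⊤ := by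
  have : CharZero (AdjoinRoot (rho ℚ)) := algebraRat.charZero _
  have : FiniteDimensional ℚ (AdjoinRoot (rho ℚ)) := Module.finite_of_finrank_pos (by rw [finrank_adjoinRoot]; norm_num)
  have hfin : Module.finrank ℚ K = 12 := by
    rw [← e.toLinearEquiv.finrank_eq, (AdjoinRoot.powerBasis f1_monic.ne_zero).finrank, AdjoinRoot.powerBasis_dim, f1_natDegree]
  refine ⟨hfin, ?_⟩
  have h0 : aeval (ev Al (AdjoinRoot.root (rho ℚ)) / ((462 : ℤ) : AdjoinRoot (rho ℚ))) f1 = 0 := by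
    rw [f1_aeval]; exact f1_root _ rho_adjoinRoot
  -- map AdjoinRoot f1 → AdjoinRoot rho
  have : Fact (Irreducible f1) := ⟨f1_irred⟩
  let φ : AdjoinRoot f1 →ₐ[ℚ] AdjoinRoot (rho ℚ) := AdjoinRoot.liftAlgHom f1 (Algebra.ofId ℚ _) _ h0
  have hinj : Function.Injective φ := φ.toRingHom.injective
  have hsurj : Function.Surjective φ := by
    have hf : FiniteDimensional ℚ (AdjoinRoot f1) := (AdjoinRoot.powerBasis f1_monic.ne_zero).finite
    have := (LinearMap.injective_iff_surjective_of_finrank_eq_finrank (f := φ.toLinearMap) (by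
      rw [finrank_adjoinRoot, (AdjoinRoot.powerBasis f1_monic.ne_zero).finrank, AdjoinRoot.powerBasis_dim, f1_natDegree])).1 hinj
    exact this
  let ψ := AlgEquiv.ofBijective φ ⟨hinj, hsurj⟩
  let χ : AdjoinRoot (rho ℚ) ≃ₐ[ℚ] K := ψ.symm.trans e
  refine ⟨χ (AdjoinRoot.root _), ?_, ?_⟩
  · have := congrArg χ rho_adjoinRoot
    rw [map_add, map_pow, map_zero] at this
    rw [← this]
    congr 1
    exact (ev_map (χ : AdjoinRoot (rho ℚ) →+* K) _ _).symm
  · have h1 : Algebra.adjoin ℚ {AdjoinRoot.root (rho ℚ)} = ⊤ := AdjoinRoot.adjoinRoot_eq_top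
    have h2 := congrArg (Subalgebra.map (χ : AdjoinRoot (rho ℚ) →ₐ[ℚ] K)) h1
    rw [AlgHom.map_adjoin, Set.image_singleton] at h2
    rw [Algebra.map_top] at h2
    rw [show χ (AdjoinRoot.root (rho ℚ)) = (χ : AdjoinRoot (rho ℚ) →ₐ[ℚ] K) (AdjoinRoot.root (rho ℚ)) from rfl, h2]
    rw [AlgHom.range_eq_top]
    exact χ.surjective

/-- transfer of splitting fields -/
lemma split_transfer (L : Type*) [Field L] [Algebra ℚ L] [IsSplittingField ℚ L (rho ℚ)] :
    IsSplittingField ℚ L f1 := by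
  classical
  have : CharZero L := algebraRat.charZero _
  have hs := IsSplittingField.splits L (rho ℚ)
  rw [rho_map] at hs
  have hsep : (rho L).Separable := by
    rw [← rho_map (algebraMap ℚ L)]
    exact (rho_irred.separable).map
  have hcard : (rho L).roots.toFinset.card = 12 := by
    rw [Multiset.toFinset_card_of_nodup (nodup_roots hsep), ← hs.natDegree_eq_card_roots, rho_natDegree]
  have hr : ∀ x ∈ (rho L).roots.toFinset, x ^ 12 + ev rl x = 0 := by
    intro x hx
    rw [Multiset.mem_toFinset, mem_roots rho_monic.ne_zero, IsRoot.def, rho_eval] at hx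
    exact hx
  have hf1 : ∀ x : L, ev f1l x = 0 → x ∈ (f1.map (algebraMap ℚ L)).roots := by
    intro x hx
    rw [mem_roots (f1_monic.map _).ne_zero, IsRoot.def, eval_map_algebraMap, f1_aeval, hx]
  have hle : (f1.map (algebraMap ℚ L)).natDegree = 12 := by rw [natDegree_map, f1_natDegree]
  refine ⟨?_, ?_⟩
  · rw [splits_iff_card_roots]
    apply le_antisymm (card_roots' _)
    rw [hle, ← hcard]
    refine le_trans ?_ (Multiset.toFinset_card_le _)
    apply Finset.card_le_card_of_injOn (fun x => ev Al x / ((462 : ℤ) : L))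
    · intro x hx
      simp only [Finset.mem_coe, Multiset.mem_toFinset]
      apply hf1
      exact f1_root x (hr x hx)
    · intro x hx y hy hxy
      rw [f1_inv x (hr x hx), f1_inv y (hr y hy)]
      simp only at hxy
      rw [hxy]
  · rw [eq_top_iff, ← IsSplittingField.adjoin_rootSet L (rho ℚ)]
    apply Algebra.adjoin_le
    intro x hx
    rw [mem_rootSet] at hx
    have hx' : x ^ 12 + ev rl x = 0 := by rw [← rho_aeval]; exact hx.2
    have : ev Pl (ev Al x / ((462 : ℤ) : L)) / ((1170432 : ℤ) : L) ∈ Algebra.adjoin ℚ (f1.rootSet L) := by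
      apply ev_mem
      apply Algebra.subset_adjoin
      rw [mem_rootSet]
      refine ⟨f1_monic.ne_zero, ?_⟩
      rw [f1_aeval]; exact f1_root x hx'
    rw [← f1_inv x hx'] at this
    exact this

lemma card_gal_transfer (L : Type*) [Field L] [Algebra ℚ L] [IsSplittingField ℚ L (rho ℚ)] :
    Nat.card f1.Gal = Nat.card (L ≃ₐ[ℚ] L) := by
  have := split_transfer L
  exact (Nat.card_congr (AlgEquiv.autCongr (IsSplittingField.algEquiv L f1)).toEquiv).symm

lemma card_gal_of (h : ∀ (L : Type) [Field L] [Algebra ℚ L] [IsSplittingField ℚ L (rho ℚ)],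
    Nat.card (L ≃ₐ[ℚ] L) = 720) : Nat.card f1.Gal = 720 := by
  rw [← @h (rho ℚ).SplittingField _ _ (IsSplittingField.splittingField (rho ℚ))]
  exact @card_gal_transfer (rho ℚ).SplittingField _ _ (IsSplittingField.splittingField (rho ℚ))

end M10

open Polynomial NumberField
set_option linter.all false
set_option linter.deprecated false
namespace M10

lemma ev_X_degree {F : Type*} [Field F] (l : List ℤ) : (ev l (X : F[X])).degree < l.length := by
  induction l with
  | nil => simp [ev]
  | cons c l ih =>
    simp only [ev]
    refine lt_of_le_of_lt (degree_add_le _ _) (max_lt ?_ ?_)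
    · rw [← map_intCast (C : F →+* F[X])]
      refine lt_of_le_of_lt degree_C_le ?_
      simp
      exact_mod_cast Nat.succ_pos _
    · rw [mul_comm, degree_mul, degree_X]
      by_cases h : ev l (X : F[X]) = 0
      · rw [h]; simp
      · rw [degree_eq_natDegree h] at ih ⊢
        simp only [List.length_cons]
        norm_cast at ih ⊢
        omega

/-- a monic list of degree less than 12 cannot vanish at 12 distinct points -/
lemma not_all {F : Type*} [Field F] (l : List ℤ) (hl : l.length < 12) (s : Multiset F)
    (hs : s.Nodup) (hc : Multiset.card s = 12) : ∃ x ∈ s, ev (l ++ [1]) x ≠ 0 := by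
  classical
  by_contra! h
  have hm := monic_X_pow_add (ev_X_degree (F := F) l)
  have hd : (X ^ l.length + ev l (X : F[X])).natDegree = l.length :=
    natDegree_eq_of_degree_eq_some (by
      rw [degree_add_eq_left_of_degree_lt] <;> rw [degree_X_pow]
      exact ev_X_degree l)
  have : s ≤ (X ^ l.length + ev l (X : F[X])).roots := by
    rw [Multiset.le_iff_subset hs]
    intro x hx
    rw [mem_roots hm.ne_zero, IsRoot.def]
    have h1 := h x hx
    rw [ev_append] at h1
    have h2 := ev_map (evalRingHom x) l (X : F[X])
    simp only [coe_evalRingHom, eval_X] at h2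
    simp [ev] at h1
    rw [eval_add, h2, eval_pow, eval_X]
    linear_combination h1
  have h2 := (Multiset.card_le_card this).trans (card_roots' _)
  rw [hd, hc] at h2
  omega

section
variable (L : Type) [Field L] [NumberField L] [IsSplittingField ℚ L (rho ℚ)]

lemma L_isGalois : IsGalois ℚ L :=
  IsGalois.of_separable_splitting_field (p := rho ℚ) rho_irred.separable

lemma frob_exists (p : ℕ) [Fact p.Prime] : ∃ (F : Type) (_ : Field F) (π : 𝓞 L →+* F) (σ : L ≃ₐ[ℚ] L),
    (p : F) = 0 ∧ ∀ x, π (σ • x) = π x ^ p := by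
  have hp : p.Prime := Fact.out
  have := L_isGalois L
  have : IsGaloisGroup (L ≃ₐ[ℚ] L) ℤ (𝓞 L) := IsGaloisGroup.of_isFractionRing _ _ _ ℚ L
  have hpr : (Ideal.span {(p : ℤ)}).IsPrime := by
    rw [Ideal.span_singleton_prime (by exact_mod_cast hp.ne_zero)]
    exact Nat.prime_iff_prime_int.1 hp
  obtain ⟨Q, -, hQ, hQ2⟩ := Ideal.exists_ideal_over_prime_of_isIntegral (S := 𝓞 L) (Ideal.span {(p : ℤ)}) ⊥ (by
    rw [Ideal.comap_bot_of_injective _ (algebraMap ℤ (𝓞 L)).injective_int]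
    exact bot_le)
  have hmem : (p : 𝓞 L) ∈ Q := by
    have : (p : ℤ) ∈ Ideal.comap (algebraMap ℤ (𝓞 L)) Q := by
      rw [hQ2]; exact Ideal.mem_span_singleton_self _
    simpa using this
  have hne : Q ≠ ⊥ := by
    rintro rfl
    have : (p : 𝓞 L) = 0 := by simpa using hmem
    exact hp.ne_zero (by exact_mod_cast this)
  have hfin : Finite (𝓞 L ⧸ Q) := Ideal.finiteQuotientOfFreeOfNeBot Q hne
  obtain ⟨σ, hσ⟩ := IsArithFrobAt.exists_of_isInvariant ℤ (L ≃ₐ[ℚ] L) Q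
  have hmax : Q.IsMaximal := hQ.isMaximal hne
  refine ⟨𝓞 L ⧸ Q, Ideal.Quotient.field Q, Ideal.Quotient.mk Q, σ, ?_, ?_⟩
  · have := (Ideal.Quotient.eq_zero_iff_mem (I := Q)).2 hmem
    simpa using this
  · intro x
    have h1 := hσ.mk_apply x
    have h2 : Nat.card (ℤ ⧸ Q.under ℤ) = p := by
      rw [Ideal.under_def, hQ2]
      rw [Nat.card_congr (Int.quotientSpanNatEquivZMod p).toEquiv, Nat.card_zmod]
    rw [h2] at h1
    exact h1

instance canLiftInt : CanLift L (𝓞 L) (algebraMap (𝓞 L) L) (IsIntegral ℤ) :=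
  ⟨fun x hx => ⟨⟨x, hx⟩, rfl⟩⟩

lemma root_integral (x : L) (hx : x ^ 12 + ev rl x = 0) : IsIntegral ℤ x := by
  refine ⟨rho ℤ, rho_monic, ?_⟩
  rw [← eval_map, rho_map, rho_eval, hx]

/-- multiset of roots in the ring of integers -/
lemma int_roots : ∃ s : Multiset (𝓞 L), s.Nodup ∧ Multiset.card s = 12 ∧
    rho (𝓞 L) = (s.map (fun a => X - C a)).prod ∧ s.map (algebraMap (𝓞 L) L) = (rho L).roots := by
  have hs := IsSplittingField.splits L (rho ℚ)
  rw [rho_map] at hs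
  have hsep : (rho L).Separable := by
    rw [← rho_map (algebraMap ℚ L)]
    exact (rho_irred.separable).map
  have hnd := nodup_roots hsep
  have hcard : Multiset.card (rho L).roots = 12 := by
    rw [← hs.natDegree_eq_card_roots, rho_natDegree]
  have hi : ∀ x ∈ (rho L).roots, IsIntegral ℤ x := by
    intro x hx
    rw [mem_roots rho_monic.ne_zero, IsRoot.def, rho_eval] at hx
    exact root_integral L x hx
  have hprod := hs.eq_prod_roots_of_monic rho_monic
  generalize hR : (rho L).roots = R at *
  lift R to Multiset (𝓞 L) using hi
  refine ⟨R, Multiset.Nodup.of_map _ hnd, by simpa using hcard, ?_, rfl⟩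
  apply map_injective (algebraMap (𝓞 L) L) (RingOfIntegers.coe_injective)
  rw [rho_map, hprod, Polynomial.map_multiset_prod]
  simp [Multiset.map_map]

variable {L}

lemma rho_root_mem (x : L) (s : Multiset (𝓞 L)) (hs : s.map (algebraMap (𝓞 L) L) = (rho L).roots)
    (hx : x ^ 12 + ev rl x = 0) : ∃ r ∈ s, algebraMap (𝓞 L) L r = x := by
  have : x ∈ (rho L).roots := by
    rw [mem_roots rho_monic.ne_zero, IsRoot.def, rho_eval, hx]
  rw [← hs, Multiset.mem_map] at this
  exact this

lemma eq_one_of_fix (σ : L ≃ₐ[ℚ] L) (h : ∀ x : L, x ^ 12 + ev rl x = 0 → σ x = x) : σ = 1 := by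
  have h1 : Algebra.adjoin ℚ ((rho ℚ).rootSet L) ≤ AlgHom.equalizer (σ : L →ₐ[ℚ] L) (AlgHom.id ℚ L) := by
    apply Algebra.adjoin_le
    intro x hx
    rw [mem_rootSet, rho_aeval] at hx
    exact h x hx.2
  rw [IsSplittingField.adjoin_rootSet L (rho ℚ)] at h1
  ext x
  exact h1 (Algebra.mem_top (x := x))

lemma sigma_root (σ : L ≃ₐ[ℚ] L) (x : L) (hx : x ^ 12 + ev rl x = 0) : (σ x) ^ 12 + ev rl (σ x) = 0 := by
  have h2 : ev rl (σ x) = σ (ev rl x) := (ev_map (σ : L →+* L) rl x).symm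
  rw [h2]
  have := congrArg σ hx
  rw [map_add, map_pow, map_zero] at this
  exact this

lemma smul_pi {F : Type} [Field F] (π : 𝓞 L →+* F) (σ : L ≃ₐ[ℚ] L) (p : ℕ)
    (h : ∀ x, π (σ • x) = π x ^ p) (k : ℕ) (x : 𝓞 L) : π ((σ ^ k) • x) = π x ^ p ^ k := by
  induction k with
  | zero => simp
  | succ k ih => rw [pow_succ', mul_smul, h, ih, ← pow_mul, pow_succ]

variable (L) in
/-- an element from Frobenius: `σ^k` for `σ` a Frobenius at `p`; it has order dividing `n`, is nontrivial
and fixes a root. -/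
lemma frob_main (p : ℕ) [Fact p.Prime] (ud : List ℤ)
    (hud : (addl (mm p ud dl) [-1]).all (fun a => a % p == 0) = true) (n k : ℕ)
    (hn : (addl (frob p (k * n)) [0, -1]).all (fun a => a % p == 0) = true)
    (g u c : List ℤ) (hg : g.length < 12) (hc : c.length < 12)
    (hu : (addl (mm p u (addl (frob p k) [0, -1])) (smull (-1) (g ++ [1]))).all (fun a => a % p == 0) = true)
    (hv : (mm p (c ++ [1]) (addl (frob p k) [0, -1])).all (fun a => a % p == 0) = true) :
    ∃ τ : L ≃ₐ[ℚ] L, τ ^ n = 1 ∧ τ ≠ 1 ∧ ∃ r : L, r ^ 12 + ev rl r = 0 ∧ τ r = r := by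
  obtain ⟨F, _, π, σ, hp0, hπ⟩ := frob_exists L p
  obtain ⟨s, hsnd, hscard, hsprod, hsroots⟩ := int_roots L
  have hroot : ∀ r ∈ s, r ^ 12 + ev rl r = 0 := by
    intro r hr
    rw [← rho_eval, hsprod, eval_multiset_prod]
    apply Multiset.prod_eq_zero
    rw [Multiset.mem_map]
    exact ⟨X - C r, Multiset.mem_map.2 ⟨r, hr, rfl⟩, by simp⟩
  have hrootF : ∀ r ∈ s, (π r) ^ 12 + ev rl (π r) = 0 := by
    intro r hr
    rw [← ev_map, ← map_pow, ← map_add, hroot r hr, map_zero]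
  have hFprod : rho F = ((s.map π).map (fun a => X - C a)).prod := by
    rw [← rho_map π, hsprod, Polynomial.map_multiset_prod]
    simp [Multiset.map_map]
  have hFroots : (rho F).roots = s.map π := by
    rw [hFprod, roots_multiset_prod_X_sub_C]
  have hnd : (s.map π).Nodup := by
    rw [← hFroots]; exact nodup_roots (rho_sep p ud hud F hp0)
  have hcard : Multiset.card (s.map π) = 12 := by simp [hscard]
  have hinj : ∀ a ∈ s, ∀ b ∈ s, π a = π b → a = b := Multiset.inj_on_of_nodup_map hnd
  have hmem : ∀ (τ : L ≃ₐ[ℚ] L), ∀ r ∈ s, τ • r ∈ s := by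
    intro τ r hr
    have h1 : (algebraMap (𝓞 L) L r) ^ 12 + ev rl (algebraMap (𝓞 L) L r) = 0 := by
      rw [← ev_map, ← map_pow, ← map_add, hroot r hr, map_zero]
    obtain ⟨r', h2, h3⟩ := rho_root_mem _ s hsroots (sigma_root τ _ h1)
    have : τ • r = r' := by
      apply RingOfIntegers.coe_injective
      rw [h3]
      rfl
    rw [this]; exact h2
  have hkey : ∀ r ∈ s, ev (addl (frob p k) [0, -1]) (π r) = π ((σ ^ k) • r) - π r := by
    intro r hr
    rw [ev_addl, ev_frob p hp0 _ (hrootF r hr), smul_pi π σ p hπ]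
    simp [ev]; ring
  refine ⟨σ ^ k, ?_, ?_, ?_⟩
  · apply eq_one_of_fix
    intro x hx
    obtain ⟨r, hr, rfl⟩ := rho_root_mem _ s hsroots hx
    have h1 : ((σ ^ k) ^ n) • r = r := by
      apply hinj _ (hmem _ r hr) _ hr
      rw [← pow_mul, smul_pi π σ p hπ]
      have := ev_zero_mod p hp0 _ hn (π r)
      rw [ev_addl, ev_frob p hp0 _ (hrootF r hr)] at this
      simp [ev] at this
      linear_combination this
    exact congrArg (algebraMap (𝓞 L) L) h1
  · intro h1
    obtain ⟨x, hx, hx2⟩ := not_all g hg _ hnd hcard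
    rw [Multiset.mem_map] at hx
    obtain ⟨r, hr, rfl⟩ := hx
    have := ev_zero_mod p hp0 _ hu (π r)
    rw [ev_addl, ev_mm (p : ℤ) (by simpa using hp0) _ (hrootF r hr), hkey r hr, h1, ev_smull] at this
    simp at this
    exact hx2 this
  · obtain ⟨x, hx, hx2⟩ := not_all c hc _ hnd hcard
    rw [Multiset.mem_map] at hx
    obtain ⟨r, hr, rfl⟩ := hx
    have := ev_zero_mod p hp0 _ hv (π r)
    rw [ev_mm (p : ℤ) (by simpa using hp0) _ (hrootF r hr), hkey r hr] at this
    rcases mul_eq_zero.1 this with h | h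
    · exact absurd h hx2
    refine ⟨algebraMap (𝓞 L) L r, ?_, ?_⟩
    · rw [← ev_map, ← map_pow, ← map_add, hroot r hr, map_zero]
    · have := hinj _ (hmem _ r hr) _ hr (sub_eq_zero.1 h)
      exact congrArg (algebraMap (𝓞 L) L) this

lemma frob_dvd (q : ℕ) (hq : q.Prime)
    (h : ∃ τ : L ≃ₐ[ℚ] L, τ ^ q = 1 ∧ τ ≠ 1 ∧ ∃ r : L, r ^ 12 + ev rl r = 0 ∧ τ r = r) :
    12 * q ∣ Nat.card (L ≃ₐ[ℚ] L) := by
  obtain ⟨τ, h1, h2, r, hr, h3⟩ := h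
  have := L_isGalois L
  have ho : orderOf τ = q := by
    have : Fact q.Prime := ⟨hq⟩
    exact orderOf_eq_prime h1 h2
  have hmin : minpoly ℚ r = rho ℚ := by
    refine (minpoly.eq_of_irreducible_of_monic rho_irred ?_ rho_monic).symm
    rw [rho_aeval, hr]
  have hfr : Module.finrank ℚ (IntermediateField.adjoin ℚ {r}) = 12 := by
    rw [IntermediateField.adjoin.finrank (.of_finite ℚ r), hmin, rho_natDegree]
  have hc := IsGaloisGroup.card_fixingSubgroup_eq_finrank (L ≃ₐ[ℚ] L) ℚ L (IntermediateField.adjoin ℚ {r})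
  have hG : Nat.card (L ≃ₐ[ℚ] L) = Module.finrank ℚ L := IsGalois.card_aut_eq_finrank ℚ L
  rw [hG, ← Module.finrank_mul_finrank ℚ (IntermediateField.adjoin ℚ {r}) L, hfr, ← hc]
  apply Nat.mul_dvd_mul_left
  have hmem : τ ∈ fixingSubgroup (L ≃ₐ[ℚ] L) (IntermediateField.adjoin ℚ {r} : Set L) := by
    rw [mem_fixingSubgroup_iff]
    intro y hy
    have : IntermediateField.adjoin ℚ {r} ≤ IntermediateField.fixedField (Subgroup.zpowers τ) := by
      rw [IntermediateField.adjoin_le_iff]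
      rintro x rfl
      rw [SetLike.mem_coe, IntermediateField.mem_fixedField_iff]
      intro f hf
      obtain ⟨m, rfl⟩ := Subgroup.mem_zpowers_iff.1 hf
      have : τ ∈ MulAction.stabilizer (L ≃ₐ[ℚ] L) x := h3
      exact Subgroup.zpow_mem _ this m
    have h4 := this hy
    rw [IntermediateField.mem_fixedField_iff] at h4
    exact h4 τ (Subgroup.mem_zpowers τ)
  rw [← ho]
  have := orderOf_dvd_natCard (⟨τ, hmem⟩ : fixingSubgroup (L ≃ₐ[ℚ] L) (IntermediateField.adjoin ℚ {r} : Set L))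
  rwa [Subgroup.orderOf_mk] at this

lemma frob5_8' : (addl (frob 5 (4 * 2)) [0, -1]).all (fun a => a % (5 : ℕ) == 0) = true := frob5_8
lemma frob23_5' : (addl (frob 23 (1 * 5)) [0, -1]).all (fun a => a % (23 : ℕ) == 0) = true := frob23_5
lemma frob17_3' : (addl (frob 17 (1 * 3)) [0, -1]).all (fun a => a % (17 : ℕ) == 0) = true := frob17_3

variable (L) in
theorem card_lower : 360 ∣ Nat.card (L ≃ₐ[ℚ] L) := by
  have p5 : Fact (Nat.Prime 5) := ⟨by norm_num⟩
  have p17 : Fact (Nat.Prime 17) := ⟨by norm_num⟩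
  have p23 : Fact (Nat.Prime 23) := ⟨by norm_num⟩
  have h2 := frob_dvd (L := L) 2 (by norm_num) (frob_main L 5 ud5 cert_d5 2 4 frob5_8'
    [2, 0, 4, 4] [0, 0, 2, 1, 0, 3, 3, 2] [3, 0, 3, 3, 2, 3, 2, 1] (by decide) (by decide)
    (by decide +kernel) (by decide +kernel))
  have h3 := frob_dvd (L := L) 3 (by norm_num) (frob_main L 17 ud17 cert_d17 3 1 frob17_3'
    [12, 7, 4] [10, 2, 5, 4, 13, 1, 2, 3, 11] [11, 12, 11, 3, 0, 8, 14, 9, 13] (by decide) (by decide)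
    (by decide +kernel) (by decide +kernel))
  have h5 := frob_dvd (L := L) 5 (by norm_num) (frob_main L 23 ud23 cert_d23 5 1 frob23_5'
    [13, 10] [9, 22, 17, 14, 2, 0, 13, 20, 18, 7] [5, 5, 9, 15, 15, 5, 7, 19, 18, 13] (by decide) (by decide)
    (by decide +kernel) (by decide +kernel))
  omega
end
end M10

open Polynomial NumberField
set_option linter.all false
set_option linter.deprecated false
namespace M10

def laA : List ℤ := [154547897336076716168276728805004990646258846060187708492705458898762758,
  191023277074966778978568748359567938172515884480726925795268014465783862,
  884422645302126625782573425567915506078928000546605337842638531266987637,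
  782673593064773525375153523402533736695125573522308274561881186675293479,
  725596617538562224684613767101709025078566692222337242323453575614081128,
  299761721555938760269025110915179971537354546111630942663024712864602483]
def laB : List ℤ := [248819874521767479037381276628815355924206324037448470855138762631918151,
  882799699562797065214937489027883164634061216839752356615096971592384944,
  846778299849210620422480561893071026707383779982797763207079615516619185,
  358359217887187827440235734899338122200195739408897578087253051777754208,
  810597949082342785279107819138120737818277472686706043009096859306215871,
  903345961593287064283472190615319816994208190969459697131630045555789437]
def dd : List (List (Fin 6 × Fin 6 × Fin 6)) := [[(0, 1, 2), (0, 1, 3), (0, 2, 4), (0, 3, 5), (0, 4, 5), (1, 2, 5), (1, 3, 4), (1, 4, 5), (2, 3, 4), (2, 3, 5)],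
  [(0, 1, 2), (0, 1, 3), (0, 2, 5), (0, 3, 4), (0, 4, 5), (1, 2, 4), (1, 3, 5), (1, 4, 5), (2, 3, 4), (2, 3, 5)],
  [(0, 1, 2), (0, 1, 4), (0, 2, 3), (0, 3, 5), (0, 4, 5), (1, 2, 5), (1, 3, 4), (1, 3, 5), (2, 3, 4), (2, 4, 5)],
  [(0, 1, 2), (0, 1, 4), (0, 2, 5), (0, 3, 4), (0, 3, 5), (1, 2, 3), (1, 3, 5), (1, 4, 5), (2, 3, 4), (2, 4, 5)],
  [(0, 1, 2), (0, 1, 5), (0, 2, 3), (0, 3, 4), (0, 4, 5), (1, 2, 4), (1, 3, 4), (1, 3, 5), (2, 3, 5), (2, 4, 5)],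
  [(0, 1, 2), (0, 1, 5), (0, 2, 4), (0, 3, 4), (0, 3, 5), (1, 2, 3), (1, 3, 4), (1, 4, 5), (2, 3, 5), (2, 4, 5)],
  [(0, 1, 3), (0, 1, 4), (0, 2, 3), (0, 2, 5), (0, 4, 5), (1, 2, 4), (1, 2, 5), (1, 3, 5), (2, 3, 4), (3, 4, 5)],
  [(0, 1, 3), (0, 1, 4), (0, 2, 4), (0, 2, 5), (0, 3, 5), (1, 2, 3), (1, 2, 5), (1, 4, 5), (2, 3, 4), (3, 4, 5)],
  [(0, 1, 3), (0, 1, 5), (0, 2, 3), (0, 2, 4), (0, 4, 5), (1, 2, 4), (1, 2, 5), (1, 3, 4), (2, 3, 5), (3, 4, 5)],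
  [(0, 1, 3), (0, 1, 5), (0, 2, 4), (0, 2, 5), (0, 3, 4), (1, 2, 3), (1, 2, 4), (1, 4, 5), (2, 3, 5), (3, 4, 5)],
  [(0, 1, 4), (0, 1, 5), (0, 2, 3), (0, 2, 4), (0, 3, 5), (1, 2, 3), (1, 2, 5), (1, 3, 4), (2, 4, 5), (3, 4, 5)],
  [(0, 1, 4), (0, 1, 5), (0, 2, 3), (0, 2, 5), (0, 3, 4), (1, 2, 3), (1, 2, 4), (1, 3, 5), (2, 4, 5), (3, 4, 5)]]
def TA : List (Fin 12) := [2, 11, 5, 1, 8, 7]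
def TB : List (Fin 12) := [11, 8, 2, 7, 5, 1]
def Sl : List ℤ := [-1436, 4310, -686, -4299, 4482, -1872, 841, -145, -50, 152, -151, 34]

def av (i : Bool × Fin 6) : ℤ := (if i.1 then laB else laA).getD i.2 0
def Tt (i : Bool × Fin 6) : Fin 12 := (if i.1 then TB else TA).getD i.2 0

/-- the triple sum attached to a design -/
def theta {R : Type*} [CommRing R] (k : Fin 12) (x : Fin 6 → R) : R :=
  ((dd.getD k []).map (fun t => x t.1 * x t.2.1 * x t.2.2)).sum

/-- the comparison value -/
def cmpv {R : Type*} [CommRing R] (k : Fin 12) (z : Bool × Fin 6 → R) (i : Bool × Fin 6) : R :=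
  ev Sl (z i) - 154 * theta k (fun j => z (!i.1, j))

lemma cert_card : ∀ k : Fin 12, (dd.getD k []).length = 10 := by decide +kernel
lemma cert_av : ∀ i, (10007 ^ 18 : ℤ) ∣ (av i) ^ 12 + ev rl (av i) := by decide +kernel
lemma cert_av' : ∀ i, ¬ (10007 : ℤ) ∣ ev dl (av i) := by decide +kernel
lemma cert_inj : ∀ i j, (10007 : ℤ) ∣ (av i - av j) → i = j := by decide +kernel
lemma cert_cmp : ∀ i, (10007 ^ 18 : ℤ) ∣ cmpv (Tt i) av i := by decide +kernel
lemma cert_uniq : ∀ i, ∀ k, (10007 : ℤ) ∣ cmpv k av i → k = Tt i := by decide +kernel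
lemma cert_swap : ∀ j : Fin 6, ¬ (10007 : ℤ) ∣ ev Sl (av (true, j)) -
    154 * theta (Tt (true, 0)) (fun j => av (false, Equiv.swap 4 5 j)) := by decide +kernel
lemma cert_Sinj : ∀ i j : Fin 6, (10007 : ℤ) ∣ ev Sl (av (true, i)) - ev Sl (av (true, j)) → i = j := by
  decide +kernel
lemma cert_sl : ∀ i, ¬ (10007 : ℤ) ∣ ev sl (av i) + (if i.1 then -1 else 1) * ev sl (av (false, 0)) := by
  decide +kernel

def gA : Fin 12 → Fin 12 := ![1, 0, 3, 2, 5, 4, 7, 6, 9, 8, 11, 10]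
def gB : Fin 12 → Fin 12 := ![11, 9, 10, 7, 5, 3, 8, 6, 4, 1, 2, 0]

lemma theta_A {R : Type*} [CommRing R] (x : Fin 6 → R) (k : Fin 12) :
    theta k (x ∘ Equiv.swap 0 1) = theta (gA k) x := by
  have e0 : Equiv.swap (0 : Fin 6) 1 0 = 1 := by decide
  have e1 : Equiv.swap (0 : Fin 6) 1 1 = 0 := by decide
  have e2 : Equiv.swap (0 : Fin 6) 1 2 = 2 := by decide
  have e3 : Equiv.swap (0 : Fin 6) 1 3 = 3 := by decide
  have e4 : Equiv.swap (0 : Fin 6) 1 4 = 4 := by decide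
  have e5 : Equiv.swap (0 : Fin 6) 1 5 = 5 := by decide
  fin_cases k <;> simp [theta, gA, dd, e0, e1, e2, e3, e4, e5] <;> ring

lemma theta_B {R : Type*} [CommRing R] (x : Fin 6 → R) (k : Fin 12) :
    theta k (x ∘ finRotate 6) = theta (gB k) x := by
  have e0 : finRotate 6 0 = 1 := by decide
  have e1 : finRotate 6 1 = 2 := by decide
  have e2 : finRotate 6 2 = 3 := by decide
  have e3 : finRotate 6 3 = 4 := by decide
  have e4 : finRotate 6 4 = 5 := by decide
  have e5 : finRotate 6 5 = 0 := by decide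
  fin_cases k <;> simp only [theta, gB, dd, Function.comp, e0, e1, e2, e3, e4, e5] <;> simp [e0, e1, e2, e3, e4, e5] <;> ring

lemma gA_bij : Function.Bijective gA := by decide +kernel
lemma gB_bij : Function.Bijective gB := by decide +kernel

lemma prod_inv {R : Type*} [CommRing R] (y : R) (π : Equiv.Perm (Fin 6)) : ∀ x : Fin 6 → R,
    ∏ k : Fin 12, (y - 154 * theta k (x ∘ π)) = ∏ k : Fin 12, (y - 154 * theta k x) := by
  have hA : ∀ x : Fin 6 → R, ∏ k : Fin 12, (y - 154 * theta k (x ∘ Equiv.swap 0 1)) = ∏ k : Fin 12, (y - 154 * theta k x) := by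
    intro x
    simp only [theta_A]
    exact gA_bij.prod_comp (fun k => y - 154 * theta k x)
  have hB : ∀ x : Fin 6 → R, ∏ k : Fin 12, (y - 154 * theta k (x ∘ finRotate 6)) = ∏ k : Fin 12, (y - 154 * theta k x) := by
    intro x
    simp only [theta_B]
    exact gB_bij.prod_comp (fun k => y - 154 * theta k x)
  have hcl : π ∈ Subgroup.closure ({finRotate 6, Equiv.swap 0 1} : Set (Equiv.Perm (Fin 6))) := by
    have := Equiv.Perm.closure_cycle_adjacent_swap (σ := finRotate 6) (isCycle_finRotate) (support_finRotate) 0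
    rw [show finRotate 6 0 = 1 by decide] at this
    rw [this]; trivial
  induction hcl using Subgroup.closure_induction with
  | mem g hg =>
    rcases hg with rfl | rfl
    · exact hB
    · exact hA
  | one => intro x; rfl
  | mul a b _ _ ha hb => intro x; rw [← ha x, ← hb (x ∘ a)]; rfl
  | inv a _ ha =>
    intro x; rw [← ha (x ∘ ⇑a⁻¹)]
    congr 1; ext k; congr 3; ext j; simp

end M10

open Polynomial NumberField
set_option linter.all false
set_option linter.deprecated false
namespace M10

instance fact_p : Fact (Nat.Prime 10007) := ⟨by norm_num⟩

section maps
variable {R S : Type*} [CommRing R] [CommRing S] (f : R →+* S)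
lemma theta_map (k : Fin 12) (x : Fin 6 → R) : f (theta k x) = theta k (fun j => f (x j)) := by
  simp [theta, map_list_sum, Function.comp_def]

lemma cmpv_map (k : Fin 12) (z : Bool × Fin 6 → R) (i : Bool × Fin 6) :
    f (cmpv k z i) = cmpv k (fun i => f (z i)) i := by
  simp only [cmpv, map_sub, map_mul, ev_map, theta_map]
  rw [show f 154 = 154 from map_ofNat f 154]
end maps

lemma hensel_root (a : ℤ) (h : (10007 ^ 18 : ℤ) ∣ a ^ 12 + ev rl a) (h' : ¬ (10007 : ℤ) ∣ ev dl a) :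
    ∃ z : ℤ_[10007], z ^ 12 + ev rl z = 0 ∧ (10007 ^ 18 : ℤ_[10007]) ∣ z - a := by
  have e1 : (rho ℤ_[10007]).eval (a : ℤ_[10007]) = ((a ^ 12 + ev rl a : ℤ) : ℤ_[10007]) := by
    rw [rho_eval]
    push_cast
    congr 1
    exact (ev_map (Int.castRingHom ℤ_[10007]) rl a).symm
  have e2 : (rho ℤ_[10007]).derivative.eval (a : ℤ_[10007]) = ((ev dl a : ℤ) : ℤ_[10007]) := by
    rw [rho_deriv]
    exact (ev_map (Int.castRingHom ℤ_[10007]) dl a).symm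
  have hd : (10007 ^ 18 : ℤ_[10007]) ∣ (rho ℤ_[10007]).eval (a : ℤ_[10007]) := by
    rw [e1]
    have := (PadicInt.pow_p_dvd_int_iff (p := 10007) 18 (a ^ 12 + ev rl a)).2 (by exact_mod_cast h)
    exact_mod_cast this
  have hn1 : ‖(rho ℤ_[10007]).derivative.eval (a : ℤ_[10007])‖ = 1 := by
    rw [e2]
    apply le_antisymm (PadicInt.norm_le_one _)
    by_contra hlt
    push_neg at hlt
    rw [PadicInt.norm_int_lt_one_iff_dvd] at hlt
    exact h' (by exact_mod_cast hlt)
  have hlt : ‖(rho ℤ_[10007]).eval (a : ℤ_[10007])‖ < 1 := by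
    rw [PadicInt.norm_lt_one_iff_dvd]
    refine dvd_trans ?_ hd
    exact dvd_pow_self _ (by norm_num)
  obtain ⟨z, hz0, hz1, -, -⟩ := hensels_lemma (F := rho ℤ_[10007]) (a := (a : ℤ_[10007])) (by
    simp only [coe_aeval_eq_eval, hn1]; simpa using hlt)
  simp only [coe_aeval_eq_eval] at hz0 hz1
  rw [hn1] at hz1
  refine ⟨z, by rw [← rho_eval]; exact hz0, ?_⟩
  obtain ⟨k, hk⟩ := binomExpansion (rho ℤ_[10007]) (a : ℤ_[10007]) (z - a)
  rw [show (a : ℤ_[10007]) + (z - a) = z by ring, hz0] at hk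
  have hu : IsUnit ((rho ℤ_[10007]).derivative.eval (a : ℤ_[10007]) + k * (z - a)) := by
    rw [PadicInt.isUnit_iff]
    have : ‖k * (z - a)‖ < 1 := by
      rw [norm_mul]
      calc _ ≤ 1 * ‖z - a‖ := by gcongr; exact PadicInt.norm_le_one _
        _ < 1 := by simpa using hz1
    rw [PadicInt.norm_add_eq_max_of_ne (by rw [hn1]; exact this.ne'), hn1, max_eq_left this.le]
  rw [← hu.dvd_mul_right]
  obtain ⟨c, hc⟩ := hd
  refine ⟨-c, ?_⟩
  linear_combination -hk - hc

section
variable (L : Type) [Field L] [NumberField L] [IsSplittingField ℚ L (rho ℚ)]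

lemma padic_main : ∃ (r : Bool × Fin 6 → L) (z : Bool × Fin 6 → ℤ_[10007]) (φ : L →+* ℚ_[10007]),
    (∀ i, φ (r i) = z i) ∧ (∀ i, PadicInt.toZModPow 18 (z i) = ((av i : ℤ) : ZMod (10007 ^ 18))) ∧
    (∀ i, (r i) ^ 12 + ev rl (r i) = 0) ∧ Function.Injective r ∧
    (∀ x : L, x ^ 12 + ev rl x = 0 → ∃ i, r i = x) := by
  classical
  choose z hz1 hz2 using fun i => hensel_root (av i) (cert_av i) (cert_av' i)
  have hz3 : ∀ i, PadicInt.toZModPow 18 (z i) = ((av i : ℤ) : ZMod (10007 ^ 18)) := by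
    intro i
    have : z i - av i ∈ RingHom.ker (PadicInt.toZModPow (p := 10007) 18) := by
      rw [PadicInt.ker_toZModPow, Ideal.mem_span_singleton]
      exact_mod_cast hz2 i
    rw [RingHom.mem_ker, map_sub, sub_eq_zero] at this
    rw [this]; simp
  have hinj : Function.Injective z := by
    intro i j hij
    apply cert_inj
    have : ((av i - av j : ℤ) : ZMod (10007 ^ 18)) = 0 := by
      push_cast; rw [← hz3, ← hz3, hij, sub_self]
    rw [ZMod.intCast_zmod_eq_zero_iff_dvd] at this
    refine dvd_trans ?_ this
    push_cast
  let zq : Bool × Fin 6 → ℚ_[10007] := fun i => z i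
  have hzq : Function.Injective zq := fun i j h => hinj (Subtype.ext h)
  have hzr : ∀ i, (zq i) ^ 12 + ev rl (zq i) = 0 := by
    intro i
    have := congrArg (PadicInt.Coe.ringHom (p := 10007)) (hz1 i)
    rw [map_add, map_pow, ev_map, map_zero] at this
    exact this
  have hsub : Finset.univ.image zq ⊆ (rho ℚ_[10007]).roots.toFinset := by
    intro x hx
    simp only [Finset.mem_image, Finset.mem_univ, true_and] at hx
    obtain ⟨i, rfl⟩ := hx
    rw [Multiset.mem_toFinset, mem_roots rho_monic.ne_zero, IsRoot.def, rho_eval, hzr]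
  have hc1 : (Finset.univ.image zq).card = 12 := by
    rw [Finset.card_image_of_injective _ hzq]; rfl
  have hc2 : (rho ℚ_[10007]).roots.toFinset.card ≤ 12 :=
    (Multiset.toFinset_card_le _).trans ((card_roots' _).trans (by rw [rho_natDegree]))
  have heq : Finset.univ.image zq = (rho ℚ_[10007]).roots.toFinset :=
    Finset.eq_of_subset_of_card_le hsub (by omega)
  have hsplit : ((rho ℚ).map (algebraMap ℚ ℚ_[10007])).Splits := by
    rw [rho_map, splits_iff_card_roots, rho_natDegree]
    apply le_antisymm ((card_roots' _).trans (by rw [rho_natDegree]))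
    rw [← hc1, heq]; exact Multiset.toFinset_card_le _
  let φ := IsSplittingField.lift L (rho ℚ) hsplit
  -- roots in L
  have hs := IsSplittingField.splits L (rho ℚ)
  rw [rho_map] at hs
  have hsep : (rho L).Separable := by
    rw [← rho_map (algebraMap ℚ L)]
    exact (rho_irred.separable).map
  have hcard : (rho L).roots.toFinset.card = 12 := by
    rw [Multiset.toFinset_card_of_nodup (nodup_roots hsep), ← hs.natDegree_eq_card_roots, rho_natDegree]
  have hmaps : (rho L).roots.toFinset.image φ = Finset.univ.image zq := by
    apply Finset.eq_of_subset_of_card_le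
    · intro x hx
      rw [Finset.mem_image] at hx
      obtain ⟨y, hy, rfl⟩ := hx
      rw [heq]
      rw [Multiset.mem_toFinset, mem_roots rho_monic.ne_zero, IsRoot.def, rho_eval] at hy ⊢
      have := congrArg (φ : L →+* ℚ_[10007]) hy
      rw [map_add, map_pow, ev_map, map_zero] at this
      exact this
    · rw [Finset.card_image_of_injective _ (show Function.Injective φ from (φ : L →+* ℚ_[10007]).injective), hcard, hc1]
  have hex : ∀ i, ∃ x : L, x ^ 12 + ev rl x = 0 ∧ φ x = zq i := by
    intro i
    have : zq i ∈ (rho L).roots.toFinset.image φ := by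
      rw [hmaps]; exact Finset.mem_image_of_mem _ (Finset.mem_univ _)
    rw [Finset.mem_image] at this
    obtain ⟨x, hx, hx2⟩ := this
    rw [Multiset.mem_toFinset, mem_roots rho_monic.ne_zero, IsRoot.def, rho_eval] at hx
    exact ⟨x, hx, hx2⟩
  choose r hr1 hr2 using hex
  refine ⟨r, z, φ, hr2, hz3, hr1, ?_, ?_⟩
  · intro i j hij
    apply hzq
    rw [← hr2, ← hr2, hij]
  · intro x hx
    have : φ x ∈ Finset.univ.image zq := by
      rw [← hmaps]
      apply Finset.mem_image_of_mem
      rw [Multiset.mem_toFinset, mem_roots rho_monic.ne_zero, IsRoot.def, rho_eval, hx]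
    rw [Finset.mem_image] at this
    obtain ⟨i, -, hi⟩ := this
    refine ⟨i, (φ : L →+* ℚ_[10007]).injective ?_⟩
    change φ (r i) = φ x
    rw [hr2, hi]
end
end M10

open Polynomial NumberField
set_option linter.all false
set_option linter.deprecated false
namespace M10

structure Dat (L : Type) [Field L] [NumberField L] where
  r : Bool × Fin 6 → L
  z : Bool × Fin 6 → ℤ_[10007]
  φ : L →+* ℚ_[10007]
  h1 : ∀ i, φ (r i) = z i
  h2 : ∀ i, PadicInt.toZModPow 18 (z i) = ((av i : ℤ) : ZMod (10007 ^ 18))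
  h3 : ∀ i, (r i) ^ 12 + ev rl (r i) = 0
  h4 : Function.Injective r
  h5 : ∀ x : L, x ^ 12 + ev rl x = 0 → ∃ i, r i = x

abbrev MP := MvPolynomial (Bool × Fin 6) ℤ

namespace Dat
variable {L : Type} [Field L] [NumberField L] (D : Dat L)

lemma toZ (p : MP) : PadicInt.toZModPow 18 (MvPolynomial.aeval D.z p) =
    ((MvPolynomial.aeval av p : ℤ) : ZMod (10007 ^ 18)) := by
  rw [MvPolynomial.aeval_def, MvPolynomial.aeval_def]
  rw [MvPolynomial.hom_eval₂]
  rw [show ((MvPolynomial.eval₂ (algebraMap ℤ ℤ) av p : ℤ) : ZMod (10007 ^ 18)) =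
    (Int.castRingHom (ZMod (10007^18))) (MvPolynomial.eval₂ (algebraMap ℤ ℤ) av p) from rfl]
  rw [MvPolynomial.hom_eval₂]
  congr 1
  · exact Subsingleton.elim _ _
  · ext i; exact D.h2 i

lemma toQ (p : MP) : D.φ (MvPolynomial.aeval D.r p) = ((MvPolynomial.aeval D.z p : ℤ_[10007]) : ℚ_[10007]) := by
  rw [MvPolynomial.aeval_def, MvPolynomial.aeval_def]
  rw [MvPolynomial.hom_eval₂]
  rw [show ((MvPolynomial.eval₂ (algebraMap ℤ ℤ_[10007]) D.z p : ℤ_[10007]) : ℚ_[10007]) =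
    (PadicInt.Coe.ringHom) (MvPolynomial.eval₂ (algebraMap ℤ ℤ_[10007]) D.z p) from rfl]
  rw [MvPolynomial.hom_eval₂]
  congr 1
  · exact Subsingleton.elim _ _
  · ext i; exact D.h1 i

lemma red18 (p : MP) (h : MvPolynomial.aeval D.r p = 0) : (10007 ^ 18 : ℤ) ∣ MvPolynomial.aeval av p := by
  have h1 := D.toQ p
  rw [h, map_zero] at h1
  have h2 : MvPolynomial.aeval D.z p = 0 := by
    apply Subtype.ext; exact h1.symm
  have h3 := D.toZ p
  rw [h2, map_zero, eq_comm, ZMod.intCast_zmod_eq_zero_iff_dvd] at h3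
  exact_mod_cast h3

lemma red (p : MP) (h : MvPolynomial.aeval D.r p = 0) : (10007 : ℤ) ∣ MvPolynomial.aeval av p :=
  dvd_trans (dvd_pow_self _ (by norm_num)) (D.red18 p h)

lemma dvdz (p : MP) (h : (10007 ^ 18 : ℤ) ∣ MvPolynomial.aeval av p) :
    (10007 ^ 18 : ℤ_[10007]) ∣ MvPolynomial.aeval D.z p := by
  have : MvPolynomial.aeval D.z p ∈ RingHom.ker (PadicInt.toZModPow (p := 10007) 18) := by
    rw [RingHom.mem_ker, D.toZ, ZMod.intCast_zmod_eq_zero_iff_dvd]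
    exact_mod_cast h
  rw [PadicInt.ker_toZModPow, Ideal.mem_span_singleton] at this
  exact_mod_cast this

lemma aeval_ev {R : Type*} [CommRing R] (x : Bool × Fin 6 → R) (l : List ℤ) (i) :
    MvPolynomial.aeval x (ev l (MvPolynomial.X i : MP)) = ev l (x i) := by
  have := ev_map (MvPolynomial.aeval x : MP →ₐ[ℤ] R).toRingHom l (MvPolynomial.X i)
  simpa using this

lemma aeval_theta {R : Type*} [CommRing R] (x : Bool × Fin 6 → R) (k) (e : Fin 6 → Bool × Fin 6) :
    MvPolynomial.aeval x (theta k (fun j => (MvPolynomial.X (e j) : MP))) = theta k (fun j => x (e j)) := by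
  have := theta_map (MvPolynomial.aeval x : MP →ₐ[ℤ] R).toRingHom k (fun j => (MvPolynomial.X (e j)))
  simpa using this

lemma aeval_cmp {R : Type*} [CommRing R] (x : Bool × Fin 6 → R) (k) (i) :
    MvPolynomial.aeval x (cmpv k (MvPolynomial.X : _ → MP) i) = cmpv k x i := by
  have := cmpv_map (MvPolynomial.aeval x : MP →ₐ[ℤ] R).toRingHom k (MvPolynomial.X) i
  simpa using this

/-- sign of a block -/
def sg (b : Bool) : ℤ := if b then -1 else 1

lemma W_eq (i : Bool × Fin 6) : ev sl (D.r i) = sg i.1 * ev sl (D.r (false, 0)) := by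
  have hsq : ∀ i, ev sl (D.r i) * ev sl (D.r i) = 2 * 66 ^ 2 := by
    intro i
    have := ev_zero_of _ cert_s (D.r i)
    rw [ev_addl, ev_mm 0 (by simp) _ (D.h3 i)] at this
    simp [ev] at this
    linear_combination this
  have hne : ev sl (D.r i) + sg i.1 * ev sl (D.r (false, 0)) ≠ 0 := by
    intro h
    apply cert_sl i
    have := D.red (ev sl (MvPolynomial.X i) + MvPolynomial.C (sg i.1) * ev sl (MvPolynomial.X (false, 0))) (by
      rw [map_add, map_mul, aeval_ev, aeval_ev, MvPolynomial.aeval_C]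
      simpa using h)
    rw [map_add, map_mul, aeval_ev, aeval_ev, MvPolynomial.aeval_C] at this
    simpa [sg] using this
  have h2 : (sg i.1 : L) ^ 2 = 1 := by
    rcases i with ⟨b, j⟩; cases b <;> simp [sg]
  have := mul_eq_zero.1 (show (ev sl (D.r i) - sg i.1 * ev sl (D.r (false, 0))) *
    (ev sl (D.r i) + sg i.1 * ev sl (D.r (false, 0))) = 0 by
      linear_combination hsq i - hsq (false, 0) - h2 * ev sl (D.r (false, 0)) ^ 2)
  rcases this with h | h
  · exact sub_eq_zero.1 h
  · exact absurd h hne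

lemma W_ne : ev sl (D.r (false, 0)) ≠ 0 := by
  intro h
  have := ev_zero_of _ cert_s (D.r (false, 0))
  rw [ev_addl, ev_mm 0 (by simp) _ (D.h3 _), h] at this
  simp [ev] at this

variable [IsSplittingField ℚ L (rho ℚ)]

lemma ev_sig (σ : L ≃ₐ[ℚ] L) (l : List ℤ) (x : L) : σ (ev l x) = ev l (σ x) :=
  ev_map (σ : L →+* L) l x

lemma exists_perm (σ : L ≃ₐ[ℚ] L) : ∃ (ε : Bool) (π : Bool → Equiv.Perm (Fin 6)),
    ∀ b j, σ (D.r (b, j)) = D.r (xor b ε, π b j) := by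
  choose τ hτ using fun i => D.h5 _ (sigma_root σ _ (D.h3 i))
  have hW : ∀ i, (sg (τ i).1 : L) = sg i.1 * sg (τ (false, 0)).1 := by
    intro i
    have h1 := congrArg σ (D.W_eq i)
    rw [map_mul, ev_sig, ev_sig, ← hτ, ← hτ, D.W_eq (τ i), D.W_eq (τ (false, 0)), map_intCast, ← mul_assoc] at h1
    exact mul_right_cancel₀ D.W_ne h1
  have hW' : ∀ i, (sg (τ i).1) = sg i.1 * sg (τ (false, 0)).1 := by
    intro i; exact_mod_cast hW i
  have hb : ∀ i, (τ i).1 = xor i.1 (τ (false, 0)).1 := by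
    intro i
    have := hW' i
    revert this
    generalize (τ i).1 = a; generalize i.1 = b; generalize (τ (false, 0)).1 = c
    revert a b c; decide
  have hinj : ∀ b, Function.Injective (fun j => (τ (b, j)).2) := by
    intro b j j' h
    have h1 : τ (b, j) = τ (b, j') := Prod.ext (by rw [hb (b, j), hb (b, j')]) h
    have h2 : D.r (b, j) = D.r (b, j') := σ.injective (by rw [← hτ, ← hτ, h1])
    exact (Prod.ext_iff.1 (D.h4 h2)).2
  refine ⟨(τ (false, 0)).1, fun b => Equiv.ofBijective _ (Finite.injective_iff_bijective.1 (hinj b)), ?_⟩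
  intro b j
  rw [← hτ]
  congr 1
  exact Prod.ext (hb _) rfl

noncomputable def Mx : MP := ∏ i : Bool × Fin 6, ∏ k : Fin 12, cmpv k MvPolynomial.X i

lemma aeval_Mx {R : Type*} [CommRing R] (x : Bool × Fin 6 → R) :
    MvPolynomial.aeval x Mx = ∏ i : Bool × Fin 6, ∏ k : Fin 12, cmpv k x i := by
  simp only [Mx, map_prod, aeval_cmp]

lemma Mx_fix (σ : L ≃ₐ[ℚ] L) : σ (∏ i : Bool × Fin 6, ∏ k : Fin 12, cmpv k D.r i) =
    ∏ i : Bool × Fin 6, ∏ k : Fin 12, cmpv k D.r i := by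
  obtain ⟨ε, π, hπ⟩ := D.exists_perm σ
  have h1 : ∀ i k, σ (cmpv k D.r i) = cmpv k (fun i => σ (D.r i)) i :=
    fun i k => cmpv_map (σ : L →+* L) k D.r i
  simp only [map_prod, h1]
  let τ : Bool × Fin 6 → Bool × Fin 6 := fun i => (xor i.1 ε, π i.1 i.2)
  have hτ : Function.Injective τ := by
    rintro ⟨b, j⟩ ⟨b', j'⟩ h
    simp only [τ, Prod.mk.injEq] at h
    obtain ⟨ha, hb⟩ := h
    have : b = b' := by clear hb; cases b <;> cases b' <;> cases ε <;> simp_all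
    subst this
    rw [(π b).injective hb]
  rw [← (Finite.injective_iff_bijective.1 hτ).prod_comp (fun i => ∏ k : Fin 12, cmpv k D.r i)]
  refine Finset.prod_congr rfl ?_
  rintro ⟨b, j⟩ -
  have := prod_inv (ev Sl (D.r (xor b ε, π b j))) (π (!b)) (fun j => D.r (!(xor b ε), j))
  simp only [cmpv, τ]
  rw [← this]
  refine Finset.prod_congr rfl ?_
  intro k _
  rw [hπ]
  congr 3
  ext j'
  simp only [Function.comp]
  rw [hπ]
  congr 2
  cases b <;> cases ε <;> rfl

lemma int_cmpv (k i) : IsIntegral ℤ (cmpv k D.r i) := by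
  rw [← aeval_cmp]
  have : ∀ p : MP, IsIntegral ℤ (MvPolynomial.aeval D.r p) := by
    intro p
    induction p using MvPolynomial.induction_on with
    | C a => rw [MvPolynomial.aeval_C]; exact isIntegral_algebraMap
    | add p q hp hq => rw [map_add]; exact hp.add hq
    | mul_X p i hp => rw [map_mul, MvPolynomial.aeval_X]; exact hp.mul (root_integral L _ (D.h3 i))
  exact this _

lemma Mx_int : ∃ m : ℤ, (∏ i : Bool × Fin 6, ∏ k : Fin 12, cmpv k D.r i) = (m : L) := by
  have := L_isGalois L
  obtain ⟨q, hq⟩ := (IsGalois.mem_range_algebraMap_iff_fixed (F := ℚ) _).2 D.Mx_fix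
  have hi : IsIntegral ℤ (∏ i : Bool × Fin 6, ∏ k : Fin 12, cmpv k D.r i) :=
    IsIntegral.prod _ fun i _ => IsIntegral.prod _ fun k _ => D.int_cmpv k i
  rw [← hq, isIntegral_algebraMap_iff (algebraMap ℚ L).injective] at hi
  obtain ⟨m, hm⟩ := IsIntegrallyClosed.isIntegral_iff.1 hi
  refine ⟨m, ?_⟩
  rw [← hq, ← hm]; simp

lemma ev_norm_le (l : List ℤ) (x : ℂ) (hx : ‖x‖ ≤ 2) : ‖ev l x‖ ≤ ((ev (l.map abs) (2:ℤ) : ℤ) : ℝ) := by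
  induction l with
  | nil => simp [ev]
  | cons c l ih =>
    simp only [ev, List.map]
    refine (norm_add_le _ _).trans ?_
    rw [norm_mul]
    push_cast
    have h1 : ‖(c : ℂ)‖ = |(c : ℝ)| := by simp
    have : ‖x‖ * ‖ev l x‖ ≤ 2 * ((ev (l.map abs) (2:ℤ) : ℤ) : ℝ) := by gcongr
    rw [h1]; linarith

lemma root_norm (x : ℂ) (hx : x ^ 12 + ev rl x = 0) : ‖x‖ ≤ 2 := by
  by_contra! h
  have h1 : x ^ 12 = 4 + 12 * x ^ 2 + 32 * x ^ 3 + (-9) * x ^ 4 + 28 * x ^ 6 + 6 * x ^ 8 := by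
    simp [ev, rl] at hx
    linear_combination hx
  have h2 : ‖x‖ ^ 12 ≤ 4 + 12 * ‖x‖ ^ 2 + 32 * ‖x‖ ^ 3 + 9 * ‖x‖ ^ 4 + 28 * ‖x‖ ^ 6 + 6 * ‖x‖ ^ 8 := by
    rw [← norm_pow, h1]
    refine (norm_add_le _ _).trans ?_
    gcongr
    · refine (norm_add_le _ _).trans ?_
      gcongr
      · refine (norm_add_le _ _).trans ?_
        gcongr
        · refine (norm_add_le _ _).trans ?_
          gcongr
          · refine (norm_add_le _ _).trans ?_
            gcongr <;> simp
          · simp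
        · simp
      · simp
    · simp
  obtain ⟨s, hs⟩ : ∃ s, ‖x‖ = 2 + s := ⟨‖x‖ - 2, by ring⟩
  have hs0 : 0 < s := by linarith
  rw [hs] at h2
  have : 0 < (2 + s) ^ 12 - (4 + 12 * (2+s) ^ 2 + 32 * (2+s) ^ 3 + 9 * (2+s) ^ 4 + 28 * (2+s) ^ 6 + 6 * (2+s) ^ 8) := by
    ring_nf; positivity
  linarith

lemma cmpv_norm (x : Bool × Fin 6 → ℂ) (hx : ∀ i, ‖x i‖ ≤ 2) (k i) : ‖cmpv k x i‖ ≤ 578392 := by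
  have h1 := ev_norm_le Sl (x i) (hx i)
  rw [show ev (Sl.map abs) (2:ℤ) = 566072 by decide +kernel] at h1
  have h2 : ‖theta k (fun j => x (!i.1, j))‖ ≤ 80 := by
    have : ∀ l : List (Fin 6 × Fin 6 × Fin 6),
        ‖(l.map (fun t => x (!i.1, t.1) * x (!i.1, t.2.1) * x (!i.1, t.2.2))).sum‖ ≤ l.length * 8 := by
      intro l
      induction l with
      | nil => simp
      | cons t l ih =>
        rw [List.map_cons, List.sum_cons]
        refine (norm_add_le _ _).trans ?_
        have : ‖x (!i.1, t.1) * x (!i.1, t.2.1) * x (!i.1, t.2.2)‖ ≤ 2 * 2 * 2 := by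
          rw [norm_mul, norm_mul]; gcongr <;> apply hx
        push_cast [List.length_cons]
        linarith
    refine (this _).trans ?_
    rw [cert_card]; norm_num
  refine (norm_sub_le _ _).trans ?_
  rw [norm_mul]
  have h3 : ‖(154 : ℂ)‖ = 154 := by simp
  rw [h3]
  push_cast at h1
  linarith

lemma Mx_zero : (∏ i : Bool × Fin 6, ∏ k : Fin 12, cmpv k D.r i) = 0 := by
  obtain ⟨m, hm⟩ := D.Mx_int
  rw [hm]
  suffices m = 0 by simp [this]
  apply Int.eq_zero_of_abs_lt_dvd (m := 10007 ^ 216)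
  · have hz : (MvPolynomial.aeval D.z Mx : ℤ_[10007]) = (m : ℤ_[10007]) := by
      have := D.toQ Mx
      rw [aeval_Mx D.r, hm, map_intCast] at this
      apply Subtype.ext
      rw [← this]; simp
    have hd : (10007 ^ 216 : ℤ_[10007]) ∣ MvPolynomial.aeval D.z Mx := by
      rw [aeval_Mx]
      have : (10007 ^ 216 : ℤ_[10007]) = ∏ i : Bool × Fin 6, 10007 ^ 18 := by
        rw [Finset.prod_const, ← pow_mul]; rfl
      rw [this]
      apply Finset.prod_dvd_prod_of_dvd
      intro i _
      refine dvd_trans ?_ (Finset.dvd_prod_of_mem _ (Finset.mem_univ (Tt i)))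
      rw [← aeval_cmp]
      apply D.dvdz
      rw [aeval_cmp]
      exact cert_cmp i
    rw [hz] at hd
    have := (PadicInt.pow_p_dvd_int_iff (p := 10007) 216 m).1 (by exact_mod_cast hd)
    exact_mod_cast this
  · obtain ⟨ψ⟩ : Nonempty (L →+* ℂ) := inferInstance
    have h1 := congrArg ψ hm
    simp only [map_prod, map_intCast, cmpv_map] at h1
    have h2 : ‖(m : ℂ)‖ ≤ ∏ i : Bool × Fin 6, ∏ k : Fin 12, (578392 : ℝ) := by
      rw [← h1, norm_prod]
      refine Finset.prod_le_prod (fun _ _ => norm_nonneg _) fun i _ => ?_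
      rw [norm_prod]
      refine Finset.prod_le_prod (fun _ _ => norm_nonneg _) fun k _ => ?_
      apply cmpv_norm
      intro i
      apply root_norm
      have := congrArg ψ (D.h3 i)
      rw [map_add, map_pow, ev_map, map_zero] at this
      exact this
    have h3 : |(m : ℝ)| ≤ 578392 ^ 144 := by
      simp only [Finset.prod_const, ← pow_mul] at h2
      simpa using h2
    have h4 : |m| ≤ 578392 ^ 144 := by exact_mod_cast h3
    refine lt_of_le_of_lt h4 ?_
    norm_num

end Dat
end M10

open Polynomial NumberField
set_option linter.all false
set_option linter.deprecated false
namespace M10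
namespace Dat
variable {L : Type} [Field L] [NumberField L] (D : Dat L) [IsSplittingField ℚ L (rho ℚ)]

lemma trans_roots (i j : Bool × Fin 6) : ∃ σ : L ≃ₐ[ℚ] L, σ (D.r i) = D.r j := by
  have := L_isGalois L
  have hm : ∀ i, minpoly ℚ (D.r i) = rho ℚ := fun i =>
    (minpoly.eq_of_irreducible_of_monic rho_irred (by rw [rho_aeval]; exact D.h3 i) rho_monic).symm
  have h := Normal.minpoly_eq_iff_mem_orbit (F := ℚ) (E := L) (x := D.r j) (y := D.r i)
  obtain ⟨σ, hσ⟩ := h.1 (by rw [hm, hm])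
  exact ⟨σ, hσ⟩

lemma sig_cmpv (σ : L ≃ₐ[ℚ] L) (k i) : σ (cmpv k D.r i) = cmpv k (fun i => σ (D.r i)) i :=
    cmpv_map (σ : L →+* L) k D.r i

lemma cmp_zero (i : Bool × Fin 6) : cmpv (Tt i) D.r i = 0 := by
  have h0 := D.Mx_zero
  rw [Finset.prod_eq_zero_iff] at h0
  obtain ⟨i0, -, h0⟩ := h0
  obtain ⟨σ, hσ⟩ := D.trans_roots i0 i
  obtain ⟨ε, π, hπ⟩ := D.exists_perm σ
  have h1 : (∏ k : Fin 12, cmpv k D.r i) = 0 := by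
    have h2 := congrArg σ h0
    rw [map_prod, map_zero] at h2
    simp only [sig_cmpv] at h2
    rw [← h2]
    obtain ⟨b, j⟩ := i0
    have := prod_inv (ev Sl (D.r (xor b ε, π b j))) (π (!b)) (fun j => D.r (!(xor b ε), j))
    have hi : i = (xor b ε, π b j) := D.h4 (by rw [← hσ, hπ])
    subst hi
    simp only [cmpv]
    rw [← this]
    refine Finset.prod_congr rfl ?_
    intro k _
    rw [hπ]
    congr 3
    ext j'
    simp only [Function.comp]
    rw [hπ]
    congr 2
    cases b <;> cases ε <;> rfl
  rw [Finset.prod_eq_zero_iff] at h1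
  obtain ⟨k, -, hk⟩ := h1
  have := D.red (cmpv k MvPolynomial.X i) (by rw [aeval_cmp, hk])
  rw [aeval_cmp] at this
  rw [← cert_uniq i k this]; exact hk

lemma four_fix (π : Equiv.Perm (Fin 6)) (h0 : π 0 = 0) (h1 : π 1 = 1) (h2 : π 2 = 2) (h3 : π 3 = 3) :
    π = 1 ∨ π = Equiv.swap 4 5 := by
  revert π; decide +kernel

lemma rigid (σ : L ≃ₐ[ℚ] L) (h : ∀ j : Fin 4, σ (D.r (false, Fin.castLE (by norm_num) j)) =
    D.r (false, Fin.castLE (by norm_num) j)) : σ = 1 := by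
  obtain ⟨ε, π, hπ⟩ := D.exists_perm σ
  have e0 : ∀ j : Fin 4, ε = false ∧ π false (Fin.castLE (by norm_num) j) = Fin.castLE (by norm_num) j := by
    intro j
    have := h j
    rw [hπ] at this
    simpa using D.h4 this
  have hε := (e0 0).1
  subst hε
  simp only [Bool.xor_false] at hπ
  -- action on the second block
  have key : ∀ j, ev Sl (D.r (true, π true j)) - 154 * theta (Tt (true, j)) (fun j => D.r (false, π false j)) = 0 := by
    intro j
    have h1 := congrArg σ (D.cmp_zero (true, j))
    rw [sig_cmpv, map_zero] at h1
    simpa only [cmpv, hπ, Bool.not_true] using h1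
  rcases four_fix (π false) (e0 0).2 (e0 1).2 (e0 2).2 (e0 3).2 with h1 | h1
  · rw [h1] at key
    have h2 : ∀ j, π true j = j := by
      intro j
      apply cert_Sinj
      have h3 := D.cmp_zero (true, j)
      have h4 := key j
      have := D.red (ev Sl (MvPolynomial.X (true, π true j)) - ev Sl (MvPolynomial.X (true, j))) (by
        rw [map_sub, aeval_ev, aeval_ev]
        simp only [cmpv, Bool.not_true] at h3
        simp only [Equiv.Perm.coe_one, id] at h4
        linear_combination h4 - h3)
      rwa [map_sub, aeval_ev, aeval_ev] at this
    apply eq_one_of_fix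
    intro x hx
    obtain ⟨⟨b, j⟩, rfl⟩ := D.h5 x hx
    rw [hπ]
    cases b
    · rw [h1]; rfl
    · rw [h2]
  · exfalso
    have h2 := key 0
    rw [h1] at h2
    apply cert_swap (π true 0)
    have := D.red (ev Sl (MvPolynomial.X (true, π true 0)) -
      MvPolynomial.C 154 * theta (Tt (true, 0)) (fun j => MvPolynomial.X (false, Equiv.swap 4 5 j))) (by
        rw [map_sub, map_mul, aeval_ev, MvPolynomial.aeval_C, aeval_theta D.r _ (fun j => (false, Equiv.swap 4 5 j))]
        simpa using h2)
    rw [map_sub, map_mul, aeval_ev, MvPolynomial.aeval_C, aeval_theta av _ (fun j => (false, Equiv.swap 4 5 j))] at this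
    simpa using this

lemma card_upper (D : Dat L) : Nat.card (L ≃ₐ[ℚ] L) ≤ 720 := by
  choose ε π hπ using D.exists_perm
  let f : (L ≃ₐ[ℚ] L) → Bool × (Fin 4 ↪ Fin 6) := fun σ =>
    (ε σ, (Fin.castLEEmb (by norm_num)).trans (π σ false).toEmbedding)
  have hf : Function.Injective f := by
    intro σ τ h
    simp only [f, Prod.mk.injEq] at h
    obtain ⟨ha, hb⟩ := h
    have h1 : τ⁻¹ * σ = 1 := by
      apply D.rigid
      intro j
      rw [AlgEquiv.mul_apply, hπ, ha]
      have : π σ false (Fin.castLE (by norm_num) j) = π τ false (Fin.castLE (by norm_num) j) := DFunLike.congr_fun hb j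
      rw [this, ← hπ]
      exact τ.symm_apply_apply _
    exact (inv_mul_eq_one.1 h1).symm
  have := Nat.card_le_card_of_injective f hf
  refine this.trans (le_of_eq ?_)
  rw [Nat.card_eq_fintype_card, Fintype.card_prod, Fintype.card_embedding_eq]
  rfl

end Dat

lemma no180 (H : Subgroup (Equiv.Perm (Fin 6))) : Nat.card H ≠ 180 := by
  intro hH
  let A := alternatingGroup (Fin 6)
  have hA : Nat.card A = 360 := by
    have := nat_card_alternatingGroup (α := Fin 6)
    rw [this]; simp; decide
  let N := H.subgroupOf A
  have hs : IsSimpleGroup A := alternatingGroup.isSimpleGroup (by simp)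
  have h1 : H.index = 4 := by
    have := H.card_mul_index
    rw [hH, Nat.card_eq_fintype_card, Fintype.card_perm] at this
    simp [Nat.factorial] at this
    omega
  have h3 : N.index ≤ 4 := by
    have := Subgroup.relIndex_le_of_le_right (H := H) (K := A) (L := ⊤) le_top (by
      rw [Subgroup.relIndex_top_right]; omega)
    rw [Subgroup.relIndex_top_right, h1] at this
    exact this
  have h4 : N ≠ ⊤ := by
    intro h
    have : A ≤ H := Subgroup.subgroupOf_eq_top.1 h
    have := Subgroup.card_le_of_le this
    omega
  rcases hs.eq_bot_or_eq_top_of_normal N.normalCore inferInstance with h | h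
  · rw [Subgroup.normalCore_eq_ker, MonoidHom.ker_eq_bot_iff] at h
    have h5 := Nat.card_le_card_of_injective _ h
    rw [Nat.card_perm] at h5
    have h6 : Nat.card (A ⧸ N) = N.index := rfl
    rw [h6, hA] at h5
    have := Nat.factorial_le h3
    have h7 : Nat.factorial 4 = 24 := rfl
    omega
  · exact h4 (top_le_iff.1 (h ▸ N.normalCore_le))

namespace Dat
variable {L : Type} [Field L] [NumberField L] (D : Dat L) [IsSplittingField ℚ L (rho ℚ)]

lemma sig_w (σ : L ≃ₐ[ℚ] L) (ε : Bool) (j : Fin 6) (h : σ (D.r (false, 0)) = D.r (ε, j)) :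
    σ (ev sl (D.r (false, 0))) = sg ε * ev sl (D.r (false, 0)) := by
  rw [ev_sig, h, D.W_eq (ε, j)]

lemma card_ne (D : Dat L) : Nat.card (L ≃ₐ[ℚ] L) ≠ 360 := by
  intro hc
  let w := ev sl (D.r (false, 0))
  have hw : w ≠ 0 := D.W_ne
  have hw2 : w ≠ -w := by
    intro h
    exact hw (self_eq_neg.1 h)
  let H := MulAction.stabilizer (L ≃ₐ[ℚ] L) w
  choose ε π hπ using D.exists_perm
  have horb : MulAction.orbit (L ≃ₐ[ℚ] L) w = {w, -w} := by
    ext x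
    simp only [MulAction.mem_orbit_iff, Set.mem_insert_iff, Set.mem_singleton_iff]
    constructor
    · rintro ⟨σ, rfl⟩
      have h1 := D.sig_w σ _ _ (hπ σ false 0)
      rw [AlgEquiv.smul_def]
      change σ w = _ at h1
      rw [h1]
      cases (false ^^ ε σ) <;> simp [sg, w]
    · rintro (rfl | rfl)
      · exact ⟨1, one_smul _ _⟩
      · obtain ⟨σ, hσ⟩ := D.trans_roots (false, 0) (true, 0)
        refine ⟨σ, ?_⟩
        have h1 := D.sig_w σ _ _ hσ
        rw [AlgEquiv.smul_def]
        change σ w = _ at h1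
        rw [h1]
        simp [sg, w]
  have hidx : H.index = 2 := by
    rw [MulAction.index_stabilizer, horb, Set.ncard_pair hw2]
  have hcH : Nat.card H = 180 := by
    have := H.card_mul_index
    rw [hidx, hc] at this
    omega
  have hε : ∀ σ : H, ε σ = false := by
    intro σ
    have h1 := D.sig_w σ _ _ (hπ σ false 0)
    have h2 : σ.1 w = w := σ.2
    change σ.1 w = _ at h1
    rw [h2] at h1
    cases h : ε σ with
    | false => rfl
    | true =>
      rw [h] at h1
      simp [sg] at h1
      exact absurd h1 hw2
  have hP : ∀ (σ : H) j, σ.1 (D.r (false, j)) = D.r (false, π σ false j) := by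
    intro σ j
    rw [hπ, hε]; rfl
  let f : H →* Equiv.Perm (Fin 6) := MonoidHom.mk' (fun σ => π σ false) (by
    intro σ τ
    ext j
    have h1 := hP (σ * τ) j
    have h2 : (σ * τ).1 (D.r (false, j)) = σ.1 (τ.1 (D.r (false, j))) := rfl
    rw [h2, hP, hP] at h1
    have := (Prod.ext_iff.1 (D.h4 h1)).2
    exact congrArg Fin.val this.symm)
  have hf : Function.Injective f := by
    rw [injective_iff_map_eq_one]
    intro σ hσ
    apply Subtype.ext
    apply D.rigid
    intro j
    rw [hP]
    have : π σ false = 1 := hσ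
    rw [this]; rfl
  apply no180 f.range
  rw [← hcH]
  exact (Nat.card_congr (f.ofInjective hf).toEquiv).symm

lemma card_eq (D : Dat L) : Nat.card (L ≃ₐ[ℚ] L) = 720 := by
  have h1 := card_lower L
  have h2 := D.card_upper
  have h3 := D.card_ne
  have : Nat.card (L ≃ₐ[ℚ] L) ≠ 0 := Nat.card_pos.ne'
  omega
end Dat

lemma card_f1 : Nat.card f1.Gal = 720 := by
  apply card_gal_of
  intro L _ _ _
  have : CharZero L := algebraRat.charZero L
  have : FiniteDimensional ℚ L := IsSplittingField.finiteDimensional L (rho ℚ)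
  have hi : ‹Algebra ℚ L› = DivisionRing.toRatAlgebra := Subsingleton.elim _ _
  subst hi
  have : NumberField L := ⟨⟩
  obtain ⟨r, z, φ, h1, h2, h3, h4, h5⟩ := padic_main L
  exact Dat.card_eq (⟨r, z, φ, h1, h2, h3, h4, h5⟩ : Dat L)

end M10

open Polynomial NumberField
set_option linter.all false
set_option linter.deprecated false
namespace M10

section dedekind
variable {K : Type} [Field K] [NumberField K] (θ : K) (h φ : ℤ[X])

lemma dvd_of_aeval_zero (hm : h.Monic) (hθ : minpoly ℚ θ = h.map (Int.castRingHom ℚ)) (F : ℤ[X])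
    (hF : aeval θ F = 0) : h ∣ F := by
  rw [← Polynomial.map_dvd_map (Int.castRingHom ℚ) Int.cast_injective hm, ← hθ]
  apply minpoly.dvd
  rw [aeval_def, eval₂_map, ← hF, aeval_def]
  congr 1
  exact Subsingleton.elim _ _

lemma dvd_lift (p : ℕ) (F : ℤ[X]) (hφm : φ.Monic) (hd : φ.map (Int.castRingHom (ZMod p)) ∣ F.map (Int.castRingHom (ZMod p))) :
    ∃ k l : ℤ[X], F = φ * k + C (p : ℤ) * l := by
  obtain ⟨c, hc⟩ := hd
  obtain ⟨k, rfl⟩ := map_surjective (Int.castRingHom (ZMod p)) (ZMod.ringHom_surjective _) c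
  rw [← Polynomial.map_mul, ← sub_eq_zero, ← Polynomial.map_sub] at hc
  have : C (p : ℤ) ∣ F - φ * k := by
    rw [C_dvd_iff_dvd_coeff]
    intro i
    have := congrArg (fun q => q.coeff i) hc
    simp only [coeff_map, coeff_zero] at this
    exact (ZMod.intCast_zmod_eq_zero_iff_dvd _ _).1 this
  obtain ⟨l, hl⟩ := this
  exact ⟨k, l, by linear_combination hl⟩

variable (hm : h.Monic) (hθ : minpoly ℚ θ = h.map (Int.castRingHom ℚ))
    (p : ℕ) [Fact p.Prime] (hφm : φ.Monic)
    (hsep : (φ.map (Int.castRingHom (ZMod p))).Separable)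
    (hdvd : φ.map (Int.castRingHom (ZMod p)) ∣ h.map (Int.castRingHom (ZMod p)))
    (T : ℤ[X]) (N : ℤ) (hN : ¬ (p : ℤ) ∣ N) (hT : aeval θ φ * aeval θ T = p * N)

include hm hθ hφm hsep hdvd hT in
lemma descent (hφ0 : aeval θ φ ≠ 0) (y : K) (hy : IsIntegral ℤ y) (a : ℤ[X]) (ha : aeval θ φ * y = aeval θ a) :
    ∃ k : ℤ[X], N * y = aeval θ k := by
  obtain ⟨m, hm1, b, hb⟩ : ∃ m : ℕ, 0 < m ∧ ∃ b : ℤ[X], (aeval θ a) ^ m = aeval θ φ * aeval θ b := by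
    obtain ⟨F, hF, hF0⟩ := hy
    have hdeg : 0 < F.natDegree := by
      by_contra h0
      have : F = 1 := hF.natDegree_eq_zero.1 (by omega)
      rw [this] at hF0; simp at hF0
    refine ⟨F.natDegree, hdeg, ?_⟩
    rw [eval₂_eq_sum_range, Finset.sum_range_succ, hF.coeff_natDegree, map_one, one_mul] at hF0
    refine ⟨-∑ i ∈ Finset.range F.natDegree, C (F.coeff i) * a ^ i * φ ^ (F.natDegree - i - 1), ?_⟩
    rw [← ha, mul_pow, eq_neg_of_add_eq_zero_right hF0, map_neg, map_sum, mul_neg, mul_neg, Finset.mul_sum, Finset.mul_sum]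
    congr 1
    refine Finset.sum_congr rfl fun i hi => ?_
    have hi' := Finset.mem_range.1 hi
    rw [map_mul, map_mul, map_pow, map_pow, ← ha, aeval_C]
    obtain ⟨d, hd⟩ : ∃ d, F.natDegree = i + 1 + d := ⟨F.natDegree - (i+1), by omega⟩
    rw [hd, show i + 1 + d - i - 1 = d by omega]
    ring
  have h1 : h ∣ a ^ m - φ * b := by
    apply dvd_of_aeval_zero θ h hm hθ
    rw [map_sub, map_pow, map_mul, hb, sub_self]
  have h2 : φ.map (Int.castRingHom (ZMod p)) ∣ (a.map (Int.castRingHom (ZMod p))) ^ m := by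
    have h3 := hdvd.trans (Polynomial.map_dvd (Int.castRingHom (ZMod p)) h1)
    rw [Polynomial.map_sub, Polynomial.map_mul, Polynomial.map_pow] at h3
    exact (dvd_iff_dvd_of_dvd_sub h3).2 (dvd_mul_right _ _)
  have h4 := hsep.squarefree.isRadical m _ h2
  obtain ⟨k, l, hk⟩ := dvd_lift φ p a hφm h4
  refine ⟨C N * k + l * T, ?_⟩
  apply mul_left_cancel₀ hφ0
  have h5 : aeval θ a = aeval θ φ * aeval θ k + p * aeval θ l := by
    rw [hk]; simp
  rw [map_add, map_mul, map_mul, aeval_C]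
  simp only [algebraMap_int_eq, eq_intCast]
  linear_combination N * ha + N * h5 - aeval θ l * hT

include hm hθ hφm hsep hdvd hT hN in
lemma dedekind (e : ℕ) (s : ℤ[X]) (hs : (aeval θ φ) ^ e = p * aeval θ s)
    (x : K) (hx : IsIntegral ℤ x) (g : ℤ[X]) (hg : p * x = aeval θ g) :
    ∃ n : ℤ, ¬ (p : ℤ) ∣ n ∧ ∃ k : ℤ[X], n * x = aeval θ k := by
  have hp : Prime (p : ℤ) := Nat.prime_iff_prime_int.1 Fact.out
  have hφ0 : aeval θ φ ≠ 0 := by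
    intro h0
    rw [h0, zero_mul] at hT
    have h1 : ((p * N : ℤ) : K) = 0 := by push_cast; exact hT.symm
    have h2 : (p * N : ℤ) = 0 := by exact_mod_cast h1
    rcases mul_eq_zero.1 h2 with h | h
    · exact hp.ne_zero h
    · exact hN (h ▸ dvd_zero _)
  have hφi : IsIntegral ℤ (aeval θ φ) := by
    have hi : IsIntegral ℤ θ := ⟨h, hm, by
      have := minpoly.aeval ℚ θ
      rw [hθ, aeval_def, eval₂_map] at this
      rw [← this]; congr 1; exact Subsingleton.elim _ _⟩
    exact IsIntegral.of_mem_of_fg _ hi.fg_adjoin_singleton _ (aeval_mem_adjoin_singleton _ _)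
  have key : ∀ e : ℕ, ∀ n : ℤ, ∀ a : ℤ[X], (aeval θ φ) ^ e * (n * x) = aeval θ a → ∃ k : ℤ[X], ((N ^ e * n : ℤ) : K) * x = aeval θ k := by
    intro e
    induction e with
    | zero => intro n a h; exact ⟨a, by simpa using h⟩
    | succ e ih =>
      intro n a h
      obtain ⟨k, hk⟩ := descent θ _ φ hm hθ p hφm hsep hdvd T N hT hφ0 ((aeval θ φ) ^ e * (n * x))
        ((hφi.pow e).mul ((isIntegral_algebraMap (R := ℤ) (x := n)).mul hx)) a (by rw [← h]; ring)
      obtain ⟨k', hk'⟩ := ih (N * n) k (by rw [← hk]; push_cast; ring)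
      exact ⟨k', by rw [← hk']; push_cast; ring⟩
  obtain ⟨k, hk⟩ := key e 1 (s * g) (by rw [hs, map_mul, ← hg]; push_cast; ring)
  refine ⟨N ^ e * 1, ?_, k, hk⟩
  rw [mul_one]
  exact fun h => hN (hp.dvd_of_dvd_pow h)

end dedekind
end M10

open Polynomial NumberField
set_option linter.all false
set_option linter.deprecated false
namespace M10

section index
variable {K : Type} [Field K] [NumberField K]

lemma index_lemma (hfin : Module.finrank ℚ K = 12) (θ : K) (h : ℤ[X]) (hm : h.Monic) (hd : h.natDegree = 12)
    (hθ : minpoly ℚ θ = h.map (Int.castRingHom ℚ)) :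
    ∃ i : ℤ, Algebra.discr ℚ (fun j : Fin 12 => θ ^ (j : ℕ)) = ((i ^ 2 * discr K : ℤ) : ℚ) ∧
      ∀ p : ℕ, p.Prime → (∀ x : K, IsIntegral ℤ x → ∀ g : ℤ[X], p * x = aeval θ g →
        ∃ n : ℤ, ¬ (p : ℤ) ∣ n ∧ ∃ k : ℤ[X], n * x = aeval θ k) → ¬ (p : ℤ) ∣ i := by
  classical
  have hi : IsIntegral ℤ θ := ⟨h, hm, by
      have := minpoly.aeval ℚ θ
      rw [hθ, aeval_def, eval₂_map] at this
      rw [← this]; congr 1; exact Subsingleton.elim _ _⟩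
  let t : 𝓞 K := ⟨θ, hi⟩
  have hcard : Fintype.card (Module.Free.ChooseBasisIndex ℤ (𝓞 K)) = 12 := by
    rw [← Module.finrank_eq_card_chooseBasisIndex, RingOfIntegers.rank, hfin]
  let b : Module.Basis (Fin 12) ℤ (𝓞 K) := (RingOfIntegers.basis K).reindex (Fintype.equivFinOfCardEq hcard)
  let P : Matrix (Fin 12) (Fin 12) ℤ := fun i j => b.repr (t ^ (j : ℕ)) i
  have hP : ∀ j : Fin 12, ∑ i, P i j • b i = t ^ (j : ℕ) := fun j => b.sum_repr _
  refine ⟨P.det, ?_, ?_⟩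
  · have h1 := Algebra.discr_of_matrix_vecMul (A := ℤ) (B := 𝓞 K) b P
    rw [NumberField.discr_eq_discr] at h1
    rw [← h1]
    have h2 : (Matrix.vecMul b (P.map (algebraMap ℤ (𝓞 K)))) = fun j : Fin 12 => t ^ (j : ℕ) := by
      funext j
      rw [← hP j]
      simp only [Matrix.vecMul, dotProduct, Matrix.map_apply]
      refine Finset.sum_congr rfl fun i _ => ?_
      rw [Algebra.smul_def, mul_comm]
    rw [h2, Algebra.discr_def, Algebra.discr_def]
    refine Eq.trans ?_ (RingHom.map_det (Int.castRingHom ℚ) _).symm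
    congr 1
    ext i j
    simp only [Algebra.traceMatrix_apply, RingHom.mapMatrix_apply, Matrix.map_apply, Algebra.traceForm_apply,
      Int.coe_castRingHom, Algebra.coe_trace_int]
    rfl
  · intro p hp hdd hdiv
    haveI : Fact p.Prime := ⟨hp⟩
    have h1 : (P.map (Int.castRingHom (ZMod p))).det = 0 := by
      have := RingHom.map_det (Int.castRingHom (ZMod p)) P
      rw [RingHom.mapMatrix_apply] at this
      rw [← this]
      exact (ZMod.intCast_zmod_eq_zero_iff_dvd _ _).2 hdiv
    obtain ⟨v, hv, hv0⟩ := Matrix.exists_mulVec_eq_zero_iff.2 h1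
    choose c hc using fun j => ZMod.intCast_surjective (v j)
    have h2 : ∀ i, (p : ℤ) ∣ ∑ j, P i j * c j := by
      intro i
      rw [← ZMod.intCast_zmod_eq_zero_iff_dvd]
      have := congrFun hv0 i
      simp only [Matrix.mulVec, dotProduct, Matrix.map_apply, Pi.zero_apply] at this
      rw [← this]
      push_cast
      refine Finset.sum_congr rfl fun j _ => ?_
      rw [hc]; rfl
    choose d hd2 using h2
    let g : ℤ[X] := ∑ j : Fin 12, C (c j) * X ^ (j : ℕ)
    have h3 : (p : 𝓞 K) * ∑ i, d i • b i = ∑ j : Fin 12, c j • t ^ (j : ℕ) := by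
      rw [Finset.mul_sum]
      simp only [← hP, Finset.smul_sum]
      rw [Finset.sum_comm]
      refine Finset.sum_congr rfl fun i _ => ?_
      simp only [smul_smul]
      rw [← Finset.sum_smul]
      have : (p : 𝓞 K) * d i • b i = ((p : ℤ) * d i) • b i := by
        simp only [zsmul_eq_mul]; push_cast; ring
      rw [this, ← hd2]
      congr 1
      exact Finset.sum_congr rfl fun j _ => mul_comm _ _
    obtain ⟨n, hn, k, hk⟩ := hdd ((∑ i, d i • b i : 𝓞 K) : K) (RingOfIntegers.isIntegral_coe _) g (by
      have := congrArg (fun z : 𝓞 K => (z : K)) h3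
      simp only [map_mul, map_natCast] at this
      rw [this]
      simp only [g, map_sum, map_mul, aeval_C, map_pow, aeval_X, zsmul_eq_mul, map_intCast]
      rfl)
    have h4 : h ∣ C n * g - C (p : ℤ) * k := by
      apply dvd_of_aeval_zero θ h hm hθ
      have hg : (p : K) * ((∑ i, d i • b i : 𝓞 K) : K) = aeval θ g := by
        have := congrArg (fun z : 𝓞 K => (z : K)) h3
        simp only [map_mul, map_natCast] at this
        rw [this]
        simp only [g, map_sum, map_mul, aeval_C, map_pow, aeval_X, zsmul_eq_mul, map_intCast]
        rfl
      rw [map_sub, map_mul, map_mul, aeval_C, aeval_C, ← hg, ← hk]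
      simp only [algebraMap_int_eq, eq_intCast, Int.cast_natCast]
      ring
    have h5 := Polynomial.map_dvd (Int.castRingHom (ZMod p)) h4
    have hp0 : (Int.castRingHom (ZMod p)) (p : ℤ) = 0 := by simp
    rw [Polynomial.map_sub, Polynomial.map_mul, Polynomial.map_mul, map_C, map_C, hp0, C_0, zero_mul, sub_zero] at h5
    have hn0 : (Int.castRingHom (ZMod p)) n ≠ 0 := fun h => hn ((ZMod.intCast_zmod_eq_zero_iff_dvd _ _).1 h)
    have h6 : h.map (Int.castRingHom (ZMod p)) ∣ g.map (Int.castRingHom (ZMod p)) :=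
      ((isUnit_C.2 hn0.isUnit).dvd_mul_left).1 h5
    have hgm : g.map (Int.castRingHom (ZMod p)) = ∑ j : Fin 12, C (v j) * X ^ (j : ℕ) := by
      simp only [g, Polynomial.map_sum, Polynomial.map_mul, map_C, Polynomial.map_pow, map_X, Int.coe_castRingHom, hc]
    have h7 : g.map (Int.castRingHom (ZMod p)) = 0 := by
      apply eq_zero_of_dvd_of_degree_lt h6
      rw [hm.degree_map, degree_eq_natDegree hm.ne_zero, hd, hgm]
      refine lt_of_le_of_lt (degree_sum_le _ _) ?_
      rw [Finset.sup_lt_iff (by exact_mod_cast WithBot.bot_lt_coe 12)]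
      intro j _
      refine lt_of_le_of_lt (degree_C_mul_X_pow_le _ _) ?_
      exact_mod_cast j.2
    apply hv
    funext j
    have := congrArg (fun q => q.coeff (j : ℕ)) (hgm.symm.trans h7)
    simp only [finset_sum_coeff, coeff_C_mul, coeff_X_pow, coeff_zero] at this
    rw [Finset.sum_eq_single j] at this
    · simpa using this
    · intro i _ hij
      rw [if_neg (fun h => hij (Fin.ext h).symm), mul_zero]
    · simp
end index
end M10

open Polynomial NumberField
set_option linter.all false
set_option linter.deprecated false
namespace M10

def xmh (hl l : List ℤ) : List ℤ :=
  if l.length = 12 then addl (0 :: l.dropLast) (smull (-(l.getLastD 0)) hl) else 0 :: l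

def mmh (hl : List ℤ) : List ℤ → List ℤ → List ℤ
  | [], _ => []
  | c :: l, b => addl (smull c b) (xmh hl (mmh hl l b))

def pownh (hl : List ℤ) (l : List ℤ) : ℕ → List ℤ
  | 0 => [1]
  | n + 1 => mmh hl (pownh hl l n) l

lemma ev_xmh {R : Type*} [CommRing R] (hl : List ℤ) (x : R) (hx : x ^ 12 + ev hl x = 0) (l : List ℤ) :
    ev (xmh hl l) x = x * ev l x := by
  unfold xmh
  split_ifs with h
  · have hne : l ≠ [] := by rintro rfl; simp at h
    have h1 : l = l.dropLast ++ [l.getLastD 0] := by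
      rw [List.getLastD_eq_getLast?, List.getLast?_eq_some_getLast hne]
      simp [List.dropLast_append_getLast hne]
    have h2 : l.dropLast.length = 11 := by simp [h]
    have h3 := ev_append l.dropLast [l.getLastD 0] x
    rw [← h1, h2] at h3
    rw [ev_addl, ev_smull, h3]
    have : ev hl x = - x ^ 12 := by linear_combination hx
    rw [this]
    simp only [ev]; push_cast; ring
  · simp [ev]

lemma ev_mmh {R : Type*} [CommRing R] (hl : List ℤ) (x : R) (hx : x ^ 12 + ev hl x = 0) (a b : List ℤ) :
    ev (mmh hl a b) x = ev a x * ev b x := by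
  induction a with
  | nil => simp [mmh, ev]
  | cons c l ih =>
    rw [mmh, ev_addl, ev_smull, ev_xmh hl x hx, ih, ev]; ring

lemma ev_pownh {R : Type*} [CommRing R] (hl : List ℤ) (x : R) (hx : x ^ 12 + ev hl x = 0) (a : List ℤ) (n : ℕ) :
    ev (pownh hl a n) x = ev a x ^ n := by
  induction n with
  | zero => simp [pownh, ev]
  | succ n ih => rw [pownh, ev_mmh hl x hx, ih, pow_succ]

lemma ev_eq_sum {R : Type*} [CommRing R] (l : List ℤ) (n : ℕ) (hl : l.length = n) (x : R) :
    ev l x = ∑ i : Fin n, ((l.getD i 0 : ℤ) : R) * x ^ (i : ℕ) := by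
  induction l generalizing n with
  | nil => subst hl; simp [ev]
  | cons c l ih =>
    subst hl
    simp only [List.length_cons]
    rw [Fin.sum_univ_succ, ev, ih _ rfl, Finset.mul_sum]
    congr 1
    · simp
    · refine Finset.sum_congr rfl fun i _ => ?_
      simp; ring

def en (L : List (List ℤ)) (i j : Fin 12) : ℤ := (L.getD i []).getD j 0

def toM (L : List (List ℤ)) : Matrix (Fin 12) (Fin 12) ℤ := fun i j => (L.getD i []).getD j 0

lemma disc_eq {K : Type} [Field K] [NumberField K] (θ : K) (hgen : Algebra.adjoin ℚ {θ} = ⊤)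
    (hfin : Module.finrank ℚ K = 12) (hl : List ℤ) (hx : θ ^ 12 + ev hl θ = 0) (R A B : List (List ℤ))
    (hlen : ∀ i : Fin 12, (R.getD i []).length = 12)
    (hstep : ∀ i : Fin 11, R.getD (i + 1 : ℕ) [] = xmh hl (R.getD i []))
    (hder : aeval θ (derivative (minpoly ℚ θ)) = ev (R.getD 0 []) θ)
    (hA : ∀ i j : Fin 12, j < i → en A i j = 0)
    (hB : ∀ i j : Fin 12, i < j → en B i j = 0)
    (hAR : ∀ i j : Fin 12, ∑ k, en A i k * en R k j = en B i j) (d : ℤ)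
    (hd : ∏ i, en B i i = d * ∏ i, en A i i) (hA0 : ∏ i, en A i i ≠ 0) :
    Algebra.discr ℚ (fun j : Fin 12 => θ ^ (j : ℕ)) = d := by
  have hint : IsIntegral ℚ θ := Algebra.IsIntegral.isIntegral θ
  let pb := PowerBasis.ofAdjoinEqTop hint hgen
  have hgenpb : pb.gen = θ := PowerBasis.ofAdjoinEqTop_gen hint hgen
  have hdim : pb.dim = 12 := by rw [← pb.finrank, hfin]
  let b : Module.Basis (Fin 12) ℚ K := pb.basis.reindex (finCongr hdim)
  have hb : ∀ j, b j = θ ^ (j : ℕ) := by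
    intro j
    simp [b, hgenpb]
  have hbf : (fun j : Fin 12 => θ ^ (j : ℕ)) = b := by funext j; rw [hb]
  have h1 : Algebra.discr ℚ b = Algebra.norm ℚ (aeval θ (derivative (minpoly ℚ θ))) := by
    have h2 := Algebra.discr_powerBasis_eq_norm ℚ pb
    rw [hgenpb, hfin] at h2
    have h3 := Algebra.discr_reindex ℚ pb.basis (finCongr hdim)
    rw [show (b : Fin 12 → K) = pb.basis ∘ (finCongr hdim).symm from Module.Basis.coe_reindex _ _, h3, h2]
    norm_num
  have hrow : ∀ j : Fin 12, ev (R.getD j []) θ = aeval θ (derivative (minpoly ℚ θ)) * θ ^ (j : ℕ) := by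
    have : ∀ n : ℕ, n < 12 → ev (R.getD n []) θ = aeval θ (derivative (minpoly ℚ θ)) * θ ^ n := by
      intro n
      induction n with
      | zero => intro _; rw [hder]; simp
      | succ n ih =>
        intro hn
        rw [hstep ⟨n, by omega⟩, ev_xmh hl θ hx, ih (by omega)]; ring
    exact fun j => this j j.2
  rw [hbf, h1, Algebra.norm_eq_matrix_det b]
  have hM : Algebra.leftMulMatrix b (aeval θ (derivative (minpoly ℚ θ))) = ((toM R).map (Int.castRingHom ℚ)).transpose := by
    ext i j
    rw [Algebra.leftMulMatrix_eq_repr_mul, hb, ← hrow, ev_eq_sum _ 12 (hlen j)]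
    have : ∀ k : Fin 12, (((R.getD j []).getD k 0 : ℤ) : K) * θ ^ (k : ℕ) = (((R.getD j []).getD k 0 : ℤ) : ℚ) • b k := by
      intro k
      rw [hb, Algebra.smul_def]; simp
    simp only [this]
    rw [b.repr_sum_self]
    rfl
  rw [hM, Matrix.det_transpose, ← RingHom.mapMatrix_apply, ← RingHom.map_det]
  have hdet : (toM A).det * (toM R).det = (toM B).det := by
    rw [← Matrix.det_mul]; congr 1; ext i j; rw [Matrix.mul_apply]; exact hAR i j
  rw [Matrix.det_of_upperTriangular (M := toM A) (fun i j h => hA i j h),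
    Matrix.det_of_lowerTriangular (toM B) (fun i j h => hB i j h), show ∏ i, toM B i i = d * ∏ i, toM A i i from hd, mul_comm] at hdet
  have := mul_right_cancel₀ hA0 hdet
  rw [this]; rfl

def dR2 : List (List ℤ) := [[0, -648, 0, -216, -1080, 216, -504, -360, 432, -180, 0, 12],
  [-1944, 0, 3240, 0, 432, 1512, -216, 360, 180, -144, 36, 0],
  [0, -1944, 0, 3240, 0, 432, 1512, -216, 360, 180, -144, 36],
  [-5832, 0, 9720, 0, 5184, 7776, -864, 4104, 1404, -1368, 828, -144],
  [23328, -5832, -46656, 9720, -7776, -25920, 12960, -11232, -2376, 8316, -3960, 828],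
  [-134136, 23328, 262440, -46656, 54432, 171072, -55728, 72576, 26028, -42120, 23220, -3960],
  [641520, -134136, -1259712, 262440, -260496, -800928, 313632, -340848, -105624, 216108, -113400, 23220],
  [-3761640, 641520, 7389144, -1259712, 1516320, 4755024, -1636848, 1985472, 704052, -1220184, 634068, -113400],
  [18370800, -3761640, -36100080, 7389144, -7383312, -22978080, 8837424, -9801648, -3117528, 6147252, -3261384, 634068],
  [-102719016, 18370800, 201676392, -36100080, 41628816, 129575376, -45804528, 54490320, 18731412, -33552792, 17560476, -3261384],
  [528344208, -102719016, -1038317616, 201676392, -212214816, -662830128, 246985200, -280624176, -92271960, 175277844, -92257704, 17560476],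
  [-2844797112, 528344208, 5586875208, -1038317616, 1149942096, 3580848000, -1295007264, 1511339472, 509597244, -935174808, 491366412, -92257704]]
def dA2 : List (List ℤ) := [[739321902139896, -812192668581474, -615297734669520, 672115350484782, -986304183457545, 77837731990173, 85872032196714, -430888075055856, 267213453984957, -72242346910653, -3802918853276, 4204333602054],
  [0, -374900383603494, -708075089288892, 163635846105114, -399010941394983, -271733969764863, 235205247798324, -352189568014884, 188363309226435, -48289705662441, -2851555346946, 2958540405434],
  [0, 0, -3587836162143132, 1527880960464462, -743551689358386, -2044960795844046, 1986472889845263, -2018756111881329, 944312967030132, -204884345237658, -19787079557919, 13025261008909],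
  [0, 0, 0, -494272459017126, -989756087763474, -153921818014560, -138711710490117, -47335128382539, 71858806143384, -44173423391624, 2949742174885, 2638661457155],
  [0, 0, 0, 0, 466857115634727, 220173792442983, -11649029856435, 126206015091774, -96563820296727, 38104772072007, -345033505297, -2239692178630],
  [0, 0, 0, 0, 0, 331321515560397, -149343757946847, 30174483177585, 1413695426964, 2507902277583, -567418951863, -275842349917],
  [0, 0, 0, 0, 0, 0, 65832082187511, -33750843272178, 3519134737890, 3250784409762, -540208633731, -135501309556],
  [0, 0, 0, 0, 0, 0, 0, -11077843399937, 7922614003834, -2158127110110, -135767934726, 118516228469],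
  [0, 0, 0, 0, 0, 0, 0, 0, -146870836132, 54726236513, 5179038972, -1958242749],
  [0, 0, 0, 0, 0, 0, 0, 0, 0, 1115913521, -167225296, -71278365],
  [0, 0, 0, 0, 0, 0, 0, 0, 0, 0, -284746, -54199],
  [0, 0, 0, 0, 0, 0, 0, 0, 0, 0, 0, 1]]
def dB2 : List (List ℤ) := [[5694591321050256, 0, 0, 0, 0, 0, 0, 0, 0, 0, 0, 0],
  [220677062104610352, 239540296293326304, 0, 0, 0, 0, 0, 0, 0, 0, 0, 0],
  [931727212802518752, 352147716967986720, -728806345725192336, 0, 0, 0, 0, 0, 0, 0, 0, 0],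
  [-911559866447487456, -259830109719034560, 2206928228553789264, 1549945222045833024, 0, 0, 0, 0, 0, 0, 0, 0],
  [276996125126303280, 306328232708901792, -602186017662212400, -957542897382973488, -320288553443097648, 0, 0, 0, 0, 0, 0, 0],
  [-470227852287725760, 418343469534951120, 860216005510378272, -775580595602672880, -132656878424724048, 605046821862606192, 0, 0, 0, 0, 0, 0],
  [-19304551016591328, -102133701627319008, 125354094132632688, 189198532829124720, -161020554951911184, 2789471750396400, 143130894722091504, 0, 0, 0, 0, 0],
  [9482923647967104, 8110171289307168, -451590419484000, -33885705167373456, -34195459214188368, 17675861035293360, -11808684815313744, -28439459505004752, 0, 0, 0, 0],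
  [-12441359599761744, -8772043561042464, 21093597500594112, 16896562793343360, 11647063273916736, 20989799545990032, 10415276110208304, 8693270909724096, 7178442523159176, 0, 0, 0],
  [-205568490819024, 17930663555616, 463053091635648, -379710415872, -24148388746368, 199887666056784, -110064854798928, 8139223849536, 9583380895752, -95172301813536, 0, 0],
  [3741258822120, 613101200544, -7146261512856, -1150769446848, -1898391664368, -5340153124512, -139949057664, -2006476423632, -1345589505396, 775874451168, -361555980804, 0],
  [-2844797112, 528344208, 5586875208, -1038317616, 1149942096, 3580848000, -1295007264, 1511339472, 509597244, -935174808, 491366412, -92257704]]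
def dR3 : List (List ℤ) := [[-288, 1776, 2664, -1980, -3480, 216, 1512, 336, -216, -120, 0, 12],
  [4416, 3168, -8880, -7992, 3960, 4872, -216, -1080, -168, 72, 24, 0],
  [0, 4416, 3168, -8880, -7992, 3960, 4872, -216, -1080, -168, 72, 24],
  [8832, 6912, -16896, -18144, 3000, 8712, 3096, -312, -1224, -504, 120, 72],
  [26496, 29568, -57024, -80832, 17496, 53112, 6120, -12456, -3336, 504, 360, 120],
  [44160, 61056, -76992, -163584, -21432, 101016, 48792, -19800, -17496, -456, 1944, 360],
  [132480, 147840, -258624, -396672, 14616, 229128, 88056, -28968, -34920, -8856, 3864, 1944],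
  [715392, 692352, -1578432, -1984896, 565608, 1367640, 159144, -331848, -110616, 11736, 14472, 3864],
  [1421952, 1828224, -2738880, -5009664, -72216, 3254952, 1228536, -675480, -494136, -17880, 58104, 14472],
  [5325696, 5589888, -11022912, -15590016, 2153976, 10000296, 2733960, -1897416, -1283304, -146808, 155784, 58104],
  [21382272, 22059648, -46006464, -62619264, 13171464, 42594360, 7908552, -9816504, -4337784, 111192, 550440, 155784],
  [57328512, 66248064, -116276544, -184342656, 14493816, 121597128, 36986136, -25740792, -16359432, -598968, 1980600, 550440]]
def dA3 : List (List ℤ) := [[-138782648, -1774060, 336369198, 75848107, -245266624, -73561420, 70319652, 27289086, -5195800, -5050344, -634074, 489275],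
  [0, -375298391036, 318503247580, 642888349861, -354901867976, -364313477268, 120719119360, 87697948914, -2965065448, -11693099600, -3634455708, 1516573157],
  [0, 0, 1596829966734, -4318266843751, -334859457908, 4140636899618, -700017836506, -1107142766786, 96959253632, 88860576982, 69220559668, -23415495751],
  [0, 0, 0, -38955110461412, 18689919136724, 39190866882880, -17123400656147, -12141998585467, 2547503468530, 1589743816118, 678674040407, -305767499837],
  [0, 0, 0, 0, -181254916074162, -50851551098400, 139373584077459, 36176811006621, -23219827561860, -10500122784362, -1612298022603, 1501770251143],
  [0, 0, 0, 0, 0, -166492791179451, -25521174899481, 79496243858382, 4893924730698, 1748510125303, -4607500134243, 631733835568],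
  [0, 0, 0, 0, 0, 0, -26185395355203, -7973751261441, 11109406327182, 2582362783834, 677301029439, -607911154139],
  [0, 0, 0, 0, 0, 0, 0, -18621982101765, 5254384797852, 177862482998, 1150352049276, -351767828119],
  [0, 0, 0, 0, 0, 0, 0, 0, -157305579387, -16637117818, -6148502886, 7632163019],
  [0, 0, 0, 0, 0, 0, 0, 0, 0, -4827775, 25460970, -6696277],
  [0, 0, 0, 0, 0, 0, 0, 0, 0, 0, 22935, -6491],
  [0, 0, 0, 0, 0, 0, 0, 0, 0, 0, 0, 1]]
def dB3 : List (List ℤ) := [[98304, 0, 0, 0, 0, 0, 0, 0, 0, 0, 0, 0],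
  [276561715200, 213170147328, 0, 0, 0, 0, 0, 0, 0, 0, 0, 0],
  [-107154992980992, -175976026156032, -72057291078912, 0, 0, 0, 0, 0, 0, 0, 0, 0],
  [-1654445267782656, -3154781886887424, -1847289644629248, -306591353612928, 0, 0, 0, 0, 0, 0, 0, 0],
  [-21604308468483072, -34971052263485952, -3219999790093056, 18106867609028736, 7479381208591104, 0, 0, 0, 0, 0, 0, 0],
  [106109078864759808, 33427934933033472, -218997750585602304, -146129426698530432, 40508507306479488, 34800943886239104, 0, 0, 0, 0, 0, 0],
  [8115597433798656, 21795781179485184, -8710045940657664, -47525130168068352, -22578955664495232, 8901572881249152, 5812111982991744, 0, 0, 0, 0, 0],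
  [-472478275575297024, -220119107353598976, 1020557721244617216, 678733530433042944, -475718756610030144, -362168126313312960, 64979345199677760, 55303554990188736, 0, 0, 0, 0],
  [-6213626915894016, -10607246065641984, 9659928497641344, 25502554506458496, 5158409294412624, -12240654852862080, -5082317308663200, 1723188698348544, 893855140884720, 0, 0, 0],
  [134814527567616, 91057927141632, -339533113502592, -284672625139968, 227904731553648, 221966491615344, -59508950339232, -68409942888096, 5298602912784, 7550667810576, 0, 0],
  [118283036928, 75921843456, -300407204736, -239604639744, 208008167184, 187614688752, -58694368656, -58058038368, 6701997072, 6438089808, -231733200, 0],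
  [57328512, 66248064, -116276544, -184342656, 14493816, 121597128, 36986136, -25740792, -16359432, -598968, 1980600, 550440]]

def h2r : List ℤ := h2l.dropLast
def h3r : List ℤ := h3l.dropLast

lemma disc2 {K : Type} [Field K] [NumberField K] (θ : K) (hgen : Algebra.adjoin ℚ {θ} = ⊤)
    (hfin : Module.finrank ℚ K = 12) (hx : θ ^ 12 + ev h2r θ = 0)
    (hm : minpoly ℚ θ = ev h2l X) :
    Algebra.discr ℚ (fun j : Fin 12 => θ ^ (j : ℕ)) = (10704715085402749997365956781525139241603956736 : ℤ) := by
  refine disc_eq θ hgen hfin h2r hx dR2 dA2 dB2 (by decide +kernel) (by decide +kernel) ?_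
    (by decide +kernel) (by decide +kernel) (by decide +kernel) _ (by decide +kernel) (by decide +kernel)
  rw [hm]
  simp [ev, h2l, dR2, map_ofNat]
  ring

lemma disc3 {K : Type} [Field K] [NumberField K] (θ : K) (hgen : Algebra.adjoin ℚ {θ} = ⊤)
    (hfin : Module.finrank ℚ K = 12) (hx : θ ^ 12 + ev h3r θ = 0)
    (hm : minpoly ℚ θ = ev h3l X) :
    Algebra.discr ℚ (fun j : Fin 12 => θ ^ (j : ℕ)) = (40154546656363633952189054976 : ℤ) := by
  refine disc_eq θ hgen hfin h3r hx dR3 dA3 dB3 (by decide +kernel) (by decide +kernel) ?_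
    (by decide +kernel) (by decide +kernel) (by decide +kernel) _ (by decide +kernel) (by decide +kernel)
  rw [hm]
  simp [ev, h3l, dR3, map_ofNat]
  ring

section fin
variable {K : Type} [Field K] [NumberField K]

lemma ev_aeval (l : List ℤ) (θ : K) : aeval θ (ev l (X : ℤ[X])) = ev l θ := by
  have := ev_map (aeval (R := ℤ) θ : ℤ[X] →ₐ[ℤ] K).toRingHom l X
  simpa using this

lemma ev_aevalQ (l : List ℤ) (θ : K) : aeval θ (ev l (X : ℚ[X])) = ev l θ := by
  have := ev_map (aeval (R := ℚ) θ : ℚ[X] →ₐ[ℚ] K).toRingHom l X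
  simpa using this

lemma ev_mapX {S : Type*} [CommRing S] (l : List ℤ) : (ev l (X : ℤ[X])).map (Int.castRingHom S) = ev l (X : S[X]) := by
  have := ev_map (mapRingHom (Int.castRingHom S)) l X
  simpa using this

lemma h2_expl : ev h2l (X : ℤ[X]) = X ^ 12 + (-18 * X ^ 10 + 48 * X ^ 9 - 45 * X ^ 8 - 72 * X ^ 7 + 36 * X ^ 6
    - 216 * X ^ 5 - 54 * X ^ 4 - 324 * X ^ 2 + 162) := by
  simp [ev, h2l]; ring

lemma h3_expl : ev h3l (X : ℤ[X]) = X ^ 12 + (-12 * X ^ 10 - 24 * X ^ 9 + 42 * X ^ 8 + 216 * X ^ 7 + 36 * X ^ 6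
    - 696 * X ^ 5 - 495 * X ^ 4 + 888 * X ^ 3 + 888 * X ^ 2 - 288 * X - 368) := by
  simp [ev, h3l]; ring

lemma h2_monic : (ev h2l (X : ℤ[X])).Monic := by
  rw [h2_expl]; monicity!
lemma h3_monic : (ev h3l (X : ℤ[X])).Monic := by
  rw [h3_expl]; monicity!
lemma h2_deg : (ev h2l (X : ℤ[X])).natDegree = 12 := by
  rw [h2_expl]; compute_degree!
lemma h3_deg : (ev h3l (X : ℤ[X])).natDegree = 12 := by
  rw [h3_expl]; compute_degree!

lemma thetaK (hfin : Module.finrank ℚ K = 12) (v : K) (hv : v ^ 12 + ev rl v = 0) (hgen : Algebra.adjoin ℚ {v} = ⊤)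
    (t V hl : List ℤ) (E : ℤ) (hE : E ≠ 0)
    (c1 : (comp 924 t hl).1.all (fun a => a == 0) = true ∧ (comp 924 t hl).2 ≠ 0)
    (c2 : (addl (comp 924 t V).1 [0, -E * (comp 924 t V).2]).all (fun a => a == 0) = true ∧ (comp 924 t V).2 ≠ 0)
    (hm : (ev hl (X : ℤ[X])).Monic) (hd : (ev hl (X : ℤ[X])).natDegree = 12) :
    ∃ θ : K, Algebra.adjoin ℚ {θ} = ⊤ ∧ ev hl θ = 0 ∧
      minpoly ℚ θ = (ev hl (X : ℤ[X])).map (Int.castRingHom ℚ) := by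
  have h0 := comp_root v hv 924 (by norm_num) t hl c1
  have := minpoly_transfer v hv hfin hgen t V 924 E (comp_inv v hv 924 (by norm_num) t V E hE c2)
    ((ev hl (X : ℤ[X])).map (Int.castRingHom ℚ)) (hm.map _) (by rw [hm.natDegree_map, hd])
    (by rw [ev_mapX, ev_aevalQ]; exact h0)
  exact ⟨_, this.1, h0, this.2⟩

def s2l : List ℤ := [-45279,-12312,86832,23976,22464,65772,7758,22572,18113,-8372,2702,508]
def T2l : List ℤ := [-13284,13608,12960,-12906,17550,126,-3006,8955,-5313,1395,81,-82]
def s3l : List ℤ := [123,96,-296,-296,166,232,-12,-72,-13,8,4,0]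
def T3l : List ℤ := [1505536,32928,-1655640,-175432,801353,165036,-180393,-64760,13165,12060,651,-928]

lemma cT2 : (addl (mmh h2r [0, 1, 1] T2l) [-162]).all (fun a => a == 0) = true := by decide +kernel
lemma cs2 : (addl (pownh h2r [0, 1, 1] 8) (smull (-2) s2l)).all (fun a => a == 0) = true := by decide +kernel
lemma cT3 : (addl (mmh h3r [1, 0, 0, 0, 1] T3l) [-1028976]).all (fun a => a == 0) = true := by decide +kernel
lemma cs3 : (addl (pownh h3r [1, 0, 0, 0, 1] 3) (smull (-3) s3l)).all (fun a => a == 0) = true := by decide +kernel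

lemma phi2_expl {S : Type*} [CommRing S] : ev [0, 1, 1] (X : S[X]) = X ^ 2 + X := by
  simp [ev]; ring
lemma phi3_expl {S : Type*} [CommRing S] : ev [1, 0, 0, 0, 1] (X : S[X]) = X ^ 4 + 1 := by
  simp [ev]; ring

lemma final2 (hfin : Module.finrank ℚ K = 12) (v : K) (hv : v ^ 12 + ev rl v = 0) (hgen : Algebra.adjoin ℚ {v} = ⊤) :
    ∃ i : ℤ, 10704715085402749997365956781525139241603956736 = i ^ 2 * discr K ∧ ¬ (2 : ℤ) ∣ i := by
  obtain ⟨θ, hg, h0, hmin⟩ := thetaK hfin v hv hgen t2l V2l h2l 18865629 (by norm_num) cert_h2 cert_V2 h2_monic h2_deg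
  have hx : θ ^ 12 + ev h2r θ = 0 := by
    rw [← h0]; simp [ev, h2r, h2l]; ring
  obtain ⟨i, hi, hp⟩ := index_lemma hfin θ _ h2_monic h2_deg hmin
  refine ⟨i, ?_, ?_⟩
  · rw [disc2 θ hg hfin hx (by rw [hmin, ev_mapX])] at hi
    exact_mod_cast hi
  · haveI : Fact (Nat.Prime 2) := ⟨Nat.prime_two⟩
    refine hp 2 Nat.prime_two fun x hxi g hgx => ?_
    refine dedekind θ _ (ev [0, 1, 1] X) h2_monic hmin 2 ?_ ?_ ?_ (ev T2l X) 81 (by norm_num) ?_ 8 (ev s2l X) ?_ x hxi g hgx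
    · rw [phi2_expl]; monicity!
    · rw [ev_mapX, phi2_expl, separable_def]
      refine ⟨0, 1, ?_⟩
      have : (2 : (ZMod 2)[X]) = 0 := by exact_mod_cast CharP.cast_eq_zero (ZMod 2)[X] 2
      rw [derivative_add, derivative_X_pow, derivative_X]
      have h2 : (((2 : ℕ) : ZMod 2)) = 0 := rfl
      rw [h2, C_0]; ring
    · rw [ev_mapX, ev_mapX, phi2_expl]
      have : (2 : (ZMod 2)[X]) = 0 := by exact_mod_cast CharP.cast_eq_zero (ZMod 2)[X] 2
      refine ⟨X ^ 7 * (X + 1) ^ 3, ?_⟩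
      simp [ev, h2l]
      linear_combination (81 - 162 * X ^ 2 - 27 * X ^ 4 - 108 * X ^ 5 + 18 * X ^ 6 - 36 * X ^ 7 - 23 * X ^ 8
        + 22 * X ^ 9 - 12 * X ^ 10 - 2 * X ^ 11) * this
    · rw [ev_aeval, ev_aeval, ← ev_mmh h2r θ hx]
      have := ev_zero_of _ cT2 θ
      rw [ev_addl] at this
      simp only [ev] at this
      push_cast at this ⊢
      linear_combination this
    · rw [ev_aeval, ev_aeval, ← ev_pownh h2r θ hx]
      have := ev_zero_of _ cs2 θ
      rw [ev_addl, ev_smull] at this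
      push_cast at this ⊢
      linear_combination this

lemma final3 (hfin : Module.finrank ℚ K = 12) (v : K) (hv : v ^ 12 + ev rl v = 0) (hgen : Algebra.adjoin ℚ {v} = ⊤) :
    ∃ i : ℤ, 40154546656363633952189054976 = i ^ 2 * discr K ∧ ¬ (3 : ℤ) ∣ i := by
  obtain ⟨θ, hg, h0, hmin⟩ := thetaK hfin v hv hgen t3l V3l h3l 64 (by norm_num) cert_h3 cert_V3 h3_monic h3_deg
  have hx : θ ^ 12 + ev h3r θ = 0 := by
    rw [← h0]; simp [ev, h3r, h3l]; ring
  obtain ⟨i, hi, hp⟩ := index_lemma hfin θ _ h3_monic h3_deg hmin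
  refine ⟨i, ?_, ?_⟩
  · rw [disc3 θ hg hfin hx (by rw [hmin, ev_mapX])] at hi
    exact_mod_cast hi
  · haveI : Fact (Nat.Prime 3) := ⟨Nat.prime_three⟩
    refine hp 3 Nat.prime_three fun x hxi g hgx => ?_
    refine dedekind θ _ (ev [1, 0, 0, 0, 1] X) h3_monic hmin 3 ?_ ?_ ?_ (ev T3l X) 342992 (by norm_num) ?_ 3 (ev s3l X) ?_ x hxi g hgx
    · rw [phi3_expl]; monicity!
    · rw [ev_mapX, phi3_expl, separable_def]
      refine ⟨1, -X, ?_⟩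
      have : (3 : (ZMod 3)[X]) = 0 := by exact_mod_cast CharP.cast_eq_zero (ZMod 3)[X] 3
      rw [derivative_add, derivative_X_pow, derivative_one]
      have h4 : (((4 : ℕ) : ZMod 3)) = 1 := rfl
      rw [h4, C_1]; ring
    · rw [ev_mapX, ev_mapX, phi3_expl]
      have : (3 : (ZMod 3)[X]) = 0 := by exact_mod_cast CharP.cast_eq_zero (ZMod 3)[X] 3
      refine ⟨(X ^ 4 + 1) ^ 2, ?_⟩
      simp [ev, h3l]
      linear_combination (-123 - 96 * X + 296 * X ^ 2 + 296 * X ^ 3 - 166 * X ^ 4 - 232 * X ^ 5 + 12 * X ^ 6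
        + 72 * X ^ 7 + 13 * X ^ 8 - 8 * X ^ 9 - 4 * X ^ 10) * this
    · rw [ev_aeval, ev_aeval, ← ev_mmh h3r θ hx]
      have := ev_zero_of _ cT3 θ
      rw [ev_addl] at this
      simp only [ev] at this
      push_cast at this ⊢
      linear_combination this
    · rw [ev_aeval, ev_aeval, ← ev_pownh h3r θ hx]
      have := ev_zero_of _ cs3 θ
      rw [ev_addl, ev_smull] at this
      push_cast at this ⊢
      linear_combination this

lemma arith (D i j : ℤ) (h2 : 10704715085402749997365956781525139241603956736 = i ^ 2 * D) (hi : ¬ (2 : ℤ) ∣ i)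
    (h3 : 40154546656363633952189054976 = j ^ 2 * D) (hj : ¬ (3 : ℤ) ∣ j) : D = 2 ^ 38 * 3 ^ 12 := by
  have hD : 0 < D := by
    by_contra h
    have := mul_nonneg (sq_nonneg j) (by linarith : (0 : ℤ) ≤ -D)
    linarith
  have c2 : IsCoprime ((2 : ℤ) ^ 38) (i ^ 2) :=
    ((Int.prime_two.coprime_iff_not_dvd).2 hi).pow
  have c3 : IsCoprime ((3 : ℤ) ^ 12) (j ^ 2) :=
    ((Int.prime_three.coprime_iff_not_dvd).2 hj).pow
  have d2 : (2 : ℤ) ^ 38 ∣ D := c2.dvd_of_dvd_mul_left (by rw [← h2]; norm_num)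
  have d3 : (3 : ℤ) ^ 12 ∣ D := c3.dvd_of_dvd_mul_left (by rw [← h3]; norm_num)
  have c : IsCoprime ((2 : ℤ) ^ 38) ((3 : ℤ) ^ 12) := by
    apply IsCoprime.pow; exact ⟨-1, 1, by norm_num⟩
  obtain ⟨w, hw⟩ := c.mul_dvd d2 d3
  have a3 : j ^ 2 * w = 2 ^ 38 := by
    have : (2 ^ 38 * 3 ^ 12 : ℤ) * (j ^ 2 * w) = (2 ^ 38 * 3 ^ 12 : ℤ) * 2 ^ 38 := by
      rw [hw] at h3; linear_combination -h3
    exact mul_left_cancel₀ (by norm_num) this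
  have a2 : i ^ 2 * w = 3 ^ 38 * 283 ^ 2 * 823 ^ 2 := by
    have : (2 ^ 38 * 3 ^ 12 : ℤ) * (i ^ 2 * w) = (2 ^ 38 * 3 ^ 12 : ℤ) * (3 ^ 38 * 283 ^ 2 * 823 ^ 2) := by
      rw [hw] at h2; linear_combination -h2
    exact mul_left_cancel₀ (by norm_num) this
  have w1 : w ∣ 1 := by
    have e1 : w ∣ 2 ^ 38 := ⟨j ^ 2, by rw [← a3]; ring⟩
    have e2 : w ∣ 3 ^ 38 * 283 ^ 2 * 823 ^ 2 := ⟨i ^ 2, by rw [← a2]; ring⟩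
    have := Int.dvd_coe_gcd e1 e2
    have hg : Int.gcd (2 ^ 38) (3 ^ 38 * 283 ^ 2 * 823 ^ 2) = 1 := by norm_num
    rwa [hg] at this
  have wpos : 0 < w := by
    by_contra h
    rw [hw] at hD
    have : (2 ^ 38 * 3 ^ 12 : ℤ) * w ≤ 0 := mul_nonpos_of_nonneg_of_nonpos (by norm_num) (by linarith)
    linarith
  have : w = 1 := by exact Int.eq_one_of_dvd_one wpos.le w1
  rw [hw, this, mul_one]

end fin
end M10

theorem m10_field_small_disc :
    Irreducible f1 ∧ f1.natDegree = 12 ∧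
    Nat.card f1.Gal = 720 ∧
    ∀ (K : Type) [Field K] [NumberField K],
      Nonempty (AdjoinRoot f1 ≃ₐ[ℚ] K) →
      Module.finrank ℚ K = 12 ∧
      NumberField.discr K = 2 ^ 38 * 3 ^ 12 := by
  refine ⟨M10.f1_irred, M10.f1_natDegree, M10.card_f1, fun K _ _ ⟨e⟩ => ?_⟩
  obtain ⟨hfin, v, hv, hgen⟩ := M10.exists_v K e
  refine ⟨hfin, ?_⟩
  obtain ⟨i, hi, hi2⟩ := M10.final2 hfin v hv hgen
  obtain ⟨j, hj, hj3⟩ := M10.final3 hfin v hv hgen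
  exact M10.arith _ i j hi hi2 hj hj3
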